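/- Under the stated hypotheses, there exist positive constants δ₀, ε₀ and C, depending only on p, μ, κ, s, c₁, C₁, v₋, v₊ and independent of α, β and T, such that if δ ≤ δ₀ and ε ≤ ε₀ then for all t ∈ [0, T]: (i) |∫₀^t (φ_xxx φ_txx/v⁵)(0,τ) dτ| ≤ C ε^{1/2} ∫₀^t ‖φ_xxxx(τ)‖² dτ + C ε^{1/2} e^{−(4/3)c₁β}; and (ii) for every η > 0 there exists C_η > 0 (independent of α, β, T) with |∫₀^t (ψ_{tx} φ_xxx)(0,τ) dτ| ≤ η ∫₀^t ‖φ_xxxx(τ)‖² dτ + C_η ∫₀^t ‖φ_xxx(τ)‖² dτ + C_η e^{−c₁β}. -/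

import Mathlib

open MeasureTheory Filter Set Real

/-- Spatial partial derivative `∂f/∂x` of a function `f(x,t)`. -/
noncomputable def pdx (f : ℝ → ℝ → ℝ) : ℝ → ℝ → ℝ := fun x t => deriv (fun y => f y t) x

/-- Temporal partial derivative `∂f/∂t` of a function `f(x,t)`. -/
noncomputable def pdt (f : ℝ → ℝ → ℝ) : ℝ → ℝ → ℝ := fun x t => deriv (fun r => f x r) t

/-- `‖f(·,t)‖²`, the squared `L²(0,∞)` norm in `x` at time `t`. -/
noncomputable def sqnorm (f : ℝ → ℝ → ℝ) (t : ℝ) : ℝ := ∫ x in Set.Ioi (0:ℝ), (f x t) ^ 2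

/-- `‖f(·,t)‖ₖ²`, the squared `Hᵏ(0,∞)` Sobolev norm in `x` at time `t`. -/
noncomputable def Hsq (k : ℕ) (f : ℝ → ℝ → ℝ) (t : ℝ) : ℝ :=
  ∑ j ∈ Finset.range (k + 1), sqnorm (pdx^[j] f) t

/-- The nonlinear source term `F` of the reformulated Navier–Stokes–Korteweg system,
where the shock profile `(V, U)` is evaluated at `ξ = x − st + α − β` and
`v = V + φ_x`. -/
noncomputable def NSKF (p : ℝ → ℝ) (μ κ s α β : ℝ) (V U : ℝ → ℝ)
    (φ ψ : ℝ → ℝ → ℝ) (x t : ℝ) : ℝ :=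
  -(p (V (x - s*t + α - β) + pdx φ x t) - p (V (x - s*t + α - β))
      - deriv p (V (x - s*t + α - β)) * pdx φ x t)
  - μ * pdx (pdx ψ) x t * pdx φ x t
      / ((V (x - s*t + α - β) + pdx φ x t) * V (x - s*t + α - β))
  + κ * deriv (deriv V) (x - s*t + α - β)
      * (1 / (V (x - s*t + α - β)) ^ 5 - 1 / (V (x - s*t + α - β) + pdx φ x t) ^ 5)
  + (5 * κ / 2) * ((pdx (pdx φ) x t) ^ 2 + 2 * pdx (pdx φ) x t * deriv V (x - s*t + α - β))
      / (V (x - s*t + α - β) + pdx φ x t) ^ 6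
  + (5 * κ / 2) * (deriv V (x - s*t + α - β)) ^ 2
      * (1 / (V (x - s*t + α - β)) ^ 6 - 1 / (V (x - s*t + α - β) + pdx φ x t) ^ 6)
  + μ * deriv U (x - s*t + α - β) * (pdx φ x t) ^ 2
      / ((V (x - s*t + α - β) + pdx φ x t) * (V (x - s*t + α - β)) ^ 2)

section Calculus

variable {f g : ℝ → ℝ → ℝ}

theorem hasDerivAt_fst_of_contDiff (hf : ContDiff ℝ (⊤ : ℕ∞) (Function.uncurry f)) (x t : ℝ) :
    HasDerivAt (fun y => f y t) (fderiv ℝ (Function.uncurry f) (x, t) (1, 0)) x := by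
  have h1 : HasFDerivAt (Function.uncurry f) (fderiv ℝ (Function.uncurry f) (x, t)) (x, t) :=
    ((hf.differentiable (by simp)) (x, t)).hasFDerivAt
  have h2 : HasDerivAt (fun y : ℝ => (y, t)) ((1 : ℝ), (0 : ℝ)) x :=
    (hasDerivAt_id x).prodMk (hasDerivAt_const x t)
  exact h1.comp_hasDerivAt x h2

theorem hasDerivAt_snd_of_contDiff (hf : ContDiff ℝ (⊤ : ℕ∞) (Function.uncurry f)) (x t : ℝ) :
    HasDerivAt (fun r => f x r) (fderiv ℝ (Function.uncurry f) (x, t) (0, 1)) t := by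
  have h1 : HasFDerivAt (Function.uncurry f) (fderiv ℝ (Function.uncurry f) (x, t)) (x, t) :=
    ((hf.differentiable (by simp)) (x, t)).hasFDerivAt
  have h2 : HasDerivAt (fun r : ℝ => (x, r)) ((0 : ℝ), (1 : ℝ)) t :=
    (hasDerivAt_const t x).prodMk (hasDerivAt_id t)
  exact h1.comp_hasDerivAt t h2

theorem uncurry_pdx (hf : ContDiff ℝ (⊤ : ℕ∞) (Function.uncurry f)) :
    Function.uncurry (pdx f) = fun z => fderiv ℝ (Function.uncurry f) z (1, 0) := by
  ext ⟨x, t⟩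
  exact (hasDerivAt_fst_of_contDiff hf x t).deriv

theorem uncurry_pdt (hf : ContDiff ℝ (⊤ : ℕ∞) (Function.uncurry f)) :
    Function.uncurry (pdt f) = fun z => fderiv ℝ (Function.uncurry f) z (0, 1) := by
  ext ⟨x, t⟩
  exact (hasDerivAt_snd_of_contDiff hf x t).deriv

theorem hasDerivAt_pdx (hf : ContDiff ℝ (⊤ : ℕ∞) (Function.uncurry f)) (x t : ℝ) :
    HasDerivAt (fun y => f y t) (pdx f x t) x :=
  (hasDerivAt_fst_of_contDiff hf x t).differentiableAt.hasDerivAt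

theorem hasDerivAt_pdt (hf : ContDiff ℝ (⊤ : ℕ∞) (Function.uncurry f)) (x t : ℝ) :
    HasDerivAt (fun r => f x r) (pdt f x t) t :=
  (hasDerivAt_snd_of_contDiff hf x t).differentiableAt.hasDerivAt

theorem contDiff_pdx (hf : ContDiff ℝ (⊤ : ℕ∞) (Function.uncurry f)) :
    ContDiff ℝ (⊤ : ℕ∞) (Function.uncurry (pdx f)) := by
  rw [uncurry_pdx hf]
  exact (hf.fderiv_right (m := (⊤ : ℕ∞)) (by simp)).clm_apply contDiff_const

theorem contDiff_pdt (hf : ContDiff ℝ (⊤ : ℕ∞) (Function.uncurry f)) :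
    ContDiff ℝ (⊤ : ℕ∞) (Function.uncurry (pdt f)) := by
  rw [uncurry_pdt hf]
  exact (hf.fderiv_right (m := (⊤ : ℕ∞)) (by simp)).clm_apply contDiff_const

theorem pdx_pdt_comm (hf : ContDiff ℝ (⊤ : ℕ∞) (Function.uncurry f)) (x t : ℝ) :
    pdx (pdt f) x t = pdt (pdx f) x t := by
  have hd : ContDiff ℝ (⊤ : ℕ∞) (fderiv ℝ (Function.uncurry f)) := hf.fderiv_right (by simp)
  have hd' := (hd.differentiable (by simp)) (x, t)
  have e1 : pdx (pdt f) x t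
      = fderiv ℝ (fderiv ℝ (Function.uncurry f)) (x, t) (1, 0) (0, 1) := by
    have h := congrFun (uncurry_pdx (contDiff_pdt hf)) (x, t)
    simp only [Function.uncurry_apply_pair] at h
    rw [h, uncurry_pdt hf, fderiv_clm_apply hd' (differentiableAt_const _)]
    simp
  have e2 : pdt (pdx f) x t
      = fderiv ℝ (fderiv ℝ (Function.uncurry f)) (x, t) (0, 1) (1, 0) := by
    have h := congrFun (uncurry_pdt (contDiff_pdx hf)) (x, t)
    simp only [Function.uncurry_apply_pair] at h
    rw [h, uncurry_pdx hf, fderiv_clm_apply hd' (differentiableAt_const _)]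
    simp
  rw [e1, e2]
  have hs : IsSymmSndFDerivAt ℝ (Function.uncurry f) (x, t) :=
    (hf.contDiffAt).isSymmSndFDerivAt (by
      simpa using WithTop.coe_le_coe.2 (le_top (a := (2 : ℕ∞))))
  exact hs _ _

theorem continuous_of_contDiff_left (hf : ContDiff ℝ (⊤ : ℕ∞) (Function.uncurry f)) (t : ℝ) :
    Continuous fun x => f x t :=
  hf.continuous.comp (by fun_prop : Continuous fun x : ℝ => (x, t))

theorem continuous_of_contDiff_right (hf : ContDiff ℝ (⊤ : ℕ∞) (Function.uncurry f)) (x : ℝ) :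
    Continuous fun t => f x t :=
  hf.continuous.comp (by fun_prop : Continuous fun t : ℝ => (x, t))

/-- Green's formula on the rectangle `[0, R] × [0, T]`. -/
theorem integral_pdt_sub_pdx (hf : ContDiff ℝ (⊤ : ℕ∞) (Function.uncurry f))
    (hg : ContDiff ℝ (⊤ : ℕ∞) (Function.uncurry g)) (R T : ℝ) :
    ∫ t in (0:ℝ)..T, ∫ x in (0:ℝ)..R, (pdt f x t - pdx g x t)
      = (∫ x in (0:ℝ)..R, (f x T - f x 0)) - ∫ t in (0:ℝ)..T, (g R t - g 0 t) := by
  have cf : Continuous (Function.uncurry (pdt f)) := (contDiff_pdt hf).continuous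
  have cg : Continuous (Function.uncurry (pdx g)) := (contDiff_pdx hg).continuous
  have cg1 : ∀ t, Continuous fun x => pdx g x t := fun t =>
    continuous_of_contDiff_left (contDiff_pdx hg) t
  have cf1 : ∀ t, Continuous fun x => pdt f x t := fun t =>
    continuous_of_contDiff_left (contDiff_pdt hf) t
  have cf2 : ∀ x, Continuous fun t => pdt f x t := fun x =>
    continuous_of_contDiff_right (contDiff_pdt hf) x
  have e1 : ∀ t, ∫ x in (0:ℝ)..R, (pdt f x t - pdx g x t)
      = (∫ x in (0:ℝ)..R, pdt f x t) - (g R t - g 0 t) := by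
    intro t
    rw [intervalIntegral.integral_sub ((cf1 t).intervalIntegrable _ _)
      ((cg1 t).intervalIntegrable _ _)]
    rw [intervalIntegral.integral_eq_sub_of_hasDerivAt (f := fun x => g x t)
      (fun x _ => hasDerivAt_pdx hg x t) ((cg1 t).intervalIntegrable _ _)]
  have c3 : Continuous fun t => ∫ x in (0:ℝ)..R, pdt f x t :=
    intervalIntegral.continuous_parametric_intervalIntegral_of_continuous' (f := fun t x => pdt f x t)
      (cf.comp (by fun_prop : Continuous fun z : ℝ × ℝ => (z.2, z.1))) _ _
  have c4 : Continuous fun t => g R t - g 0 t :=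
    (continuous_of_contDiff_right hg R).sub (continuous_of_contDiff_right hg 0)
  simp_rw [e1]
  rw [intervalIntegral.integral_sub (c3.intervalIntegrable _ _) (c4.intervalIntegrable _ _)]
  congr 1
  rw [intervalIntegral_intervalIntegral_swap (F := fun t x => pdt f x t)]
  · refine intervalIntegral.integral_congr fun x _ => ?_
    exact intervalIntegral.integral_eq_sub_of_hasDerivAt (f := fun t => f x t)
      (fun t _ => hasDerivAt_pdt hf x t) ((cf2 x).intervalIntegrable _ _)
  · have c5 : Continuous fun z : ℝ × ℝ => pdt f z.2 z.1 :=
      cf.comp (by fun_prop : Continuous fun z : ℝ × ℝ => (z.2, z.1))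
    exact (c5.continuousOn.integrableOn_compact
      (isCompact_uIcc.prod isCompact_uIcc)).mono_set
        (Set.prod_mono Set.uIoc_subset_uIcc Set.uIoc_subset_uIcc)

end Calculus

/-- One-dimensional Sobolev inequality on the half-line, with a free Young parameter. -/
theorem sq_le_of_integrableOn_Ioi {f f' : ℝ → ℝ} (hd : ∀ x, HasDerivAt f (f' x) x)
    (hc : Continuous f') (h1 : IntegrableOn (fun x => f x ^ 2) (Ioi 0))
    (h2 : IntegrableOn (fun x => f' x ^ 2) (Ioi 0)) (h0 : Tendsto f atTop (nhds 0))
    {θ : ℝ} (hθ : 0 < θ) {x : ℝ} (hx : 0 ≤ x) :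
    f x ^ 2 ≤ θ * (∫ y in Ioi (0:ℝ), f y ^ 2) + θ⁻¹ * ∫ y in Ioi (0:ℝ), f' y ^ 2 := by
  have cf : Continuous f := continuous_iff_continuousAt.2 fun y => (hd y).continuousAt
  have key : ∀ y, |2 * f y * f' y| ≤ θ * f y ^ 2 + θ⁻¹ * f' y ^ 2 := by
    intro y
    have e : θ * f y ^ 2 + θ⁻¹ * f' y ^ 2 - 2 * f y * f' y = θ⁻¹ * (θ * f y - f' y) ^ 2 := by
      field_simp; ring
    have e' : θ * f y ^ 2 + θ⁻¹ * f' y ^ 2 + 2 * f y * f' y = θ⁻¹ * (θ * f y + f' y) ^ 2 := by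
      field_simp; ring
    have p1 : 0 ≤ θ⁻¹ * (θ * f y - f' y) ^ 2 := by positivity
    have p2 : 0 ≤ θ⁻¹ * (θ * f y + f' y) ^ 2 := by positivity
    rw [abs_le]
    constructor <;> linarith
  have hi : IntegrableOn (fun y => θ * f y ^ 2 + θ⁻¹ * f' y ^ 2) (Ioi 0) :=
    (h1.const_mul θ).add (h2.const_mul θ⁻¹)
  have hi' : IntegrableOn (fun y => 2 * f y * f' y) (Ioi 0) := by
    refine hi.mono' (by fun_prop) (ae_of_all _ fun y => ?_)
    exact key y
  have hsub : Ioi x ⊆ Ioi (0:ℝ) := Ioi_subset_Ioi hx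
  have hF : ∫ y in Ioi x, 2 * f y * f' y = 0 ^ 2 - f x ^ 2 := by
    refine integral_Ioi_of_hasDerivAt_of_tendsto' (f := fun y => f y ^ 2) (fun y _ => ?_)
      (hi'.mono_set hsub) (h0.pow 2)
    simpa using (hd y).fun_pow 2
  calc f x ^ 2 = -∫ y in Ioi x, 2 * f y * f' y := by rw [hF]; ring
    _ ≤ ∫ y in Ioi x, (θ * f y ^ 2 + θ⁻¹ * f' y ^ 2) := by
        rw [← integral_neg]
        refine setIntegral_mono (hi'.mono_set hsub).neg (hi.mono_set hsub) fun y => ?_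
        exact (neg_le_abs _).trans (key y)
    _ ≤ ∫ y in Ioi 0, (θ * f y ^ 2 + θ⁻¹ * f' y ^ 2) :=
        setIntegral_mono_set hi (ae_of_all _ fun y => by positivity) hsub.eventuallyLE
    _ = _ := by
        rw [integral_add (h1.const_mul θ) (h2.const_mul θ⁻¹), integral_const_mul,
          integral_const_mul]

set_option maxHeartbeats 1000000 in
/-- Coercivity of the mixed energy form, with the powers of the density and the quotients by them
replaced by bounded independent variables. -/
theorem energy_form_le {H q k₀ l κ v₃ v₄ v₅ m k vx w a a₁ b₁ A B r e z z' n : ℝ}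
    (hH0 : 0 < H) (hq0 : 0 < q) (hk₀0 : 0 < k₀) (hl0 : 0 < l)
    (hl1 : l ≤ q / 4) (hl2 : l ≤ q * k₀ / (4 * H ^ 2))
    (b1 : |(1 : ℝ)| ≤ H) (bl : |l| ≤ H) (bκ : |κ| ≤ H) (b3 : |v₃| ≤ H) (b4 : |v₄| ≤ H)
    (b5 : |v₅| ≤ H) (bm : |m| ≤ H) (bk : |k| ≤ H) (bvx : |vx| ≤ H) (bw : |w| ≤ H) (ba : |a| ≤ H)
    (hz : |z| ≤ 1) (hz' : |z'| ≤ 1) (hn : 0 ≤ n) (ha₁ : |a₁| ≤ n) (hb₁ : |b₁| ≤ n) (hr : |r| ≤ n)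
    (hk : v₅ * k = κ) (kk : k₀ ≤ k) (hq4 : q ≤ v₅ * m) (he : e = m * A - k * B + r) :
    z ^ 2 * (5 / 2 * v₄ * w * a₁ ^ 2 - v₅ * A * e - 5 * v₄ * vx * a₁ * e - κ * B * A
          + l * (e * B + A ^ 2)
          - 5 / 2 * (4 * v₃ * vx * a * a₁ ^ 2 + 2 * v₄ * a * a₁ * A))
        - 2 * z * z' * (v₅ * a₁ * e + κ * b₁ * A - l * (e * b₁ + a₁ * A)
          + 5 / 2 * v₄ * a * a₁ ^ 2)
      ≤ -(l * k₀ / 2 * (z * B) ^ 2)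
        + ((40 * H ^ 4) ^ 2 / q + (40 * H ^ 4) ^ 2 / (l * k₀) + 40 * H ^ 4) * n ^ 2 := by
  have hH1 : 1 ≤ H := by simpa using b1
  have bz : |z| ≤ H := hz.trans hH1
  have bz' : |z'| ≤ H := hz'.trans hH1
  have bzz : |z * z| ≤ H := by
    rw [abs_mul]
    have := mul_le_mul hz hz (abs_nonneg _) zero_le_one
    linarith only [this, hH1]
  have bzz' : |z * z'| ≤ H := by
    rw [abs_mul]
    have := mul_le_mul hz hz' (abs_nonneg _) zero_le_one
    linarith only [this, hH1]
  have mono : ∀ x₁ x₂ x₃ x₄ y N : ℝ, |x₁| ≤ H → |x₂| ≤ H → |x₃| ≤ H → |x₄| ≤ H → |y| ≤ N →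
      |x₁ * x₂ * x₃ * x₄ * y| ≤ H ^ 4 * N := by
    intro x₁ x₂ x₃ x₄ y N h1 h2 h3 h4 h5
    calc |x₁ * x₂ * x₃ * x₄ * y| = |x₁| * |x₂| * |x₃| * |x₄| * |y| := by simp only [abs_mul]
      _ ≤ H * H * H * H * N := by gcongr
      _ = H ^ 4 * N := by ring
  have quad : ∀ x y : ℝ, |x| ≤ n → |y| ≤ n → |x * y| ≤ n ^ 2 := by
    intro x y hx hy
    rw [abs_mul, sq]
    exact mul_le_mul hx hy (abs_nonneg _) hn
  obtain ⟨L₁, hL₁, bL₁⟩ : ∃ L₁, L₁ = -(z * v₅) * r + (z * (-5 * v₄ * vx * m - 5 * v₄ * a)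
      - 2 * z' * (v₅ * m - l)) * a₁ - 2 * z' * (κ - l * m) * b₁ ∧ |L₁| ≤ 40 * H ^ 4 * n := by
    refine ⟨_, rfl, ?_⟩
    have t1 := abs_le.1 (mono z v₅ 1 1 r n bz b5 b1 b1 hr)
    have t2 := abs_le.1 (mono z v₄ vx m a₁ n bz b4 bvx bm ha₁)
    have t3 := abs_le.1 (mono z v₄ a 1 a₁ n bz b4 ba b1 ha₁)
    have t4 := abs_le.1 (mono z' v₅ m 1 a₁ n bz' b5 bm b1 ha₁)
    have t5 := abs_le.1 (mono z' l 1 1 a₁ n bz' bl b1 b1 ha₁)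
    have t6 := abs_le.1 (mono z' κ 1 1 b₁ n bz' bκ b1 b1 hb₁)
    have t7 := abs_le.1 (mono z' l m 1 b₁ n bz' bl bm b1 hb₁)
    have hHn : 0 ≤ H ^ 4 * n := by positivity
    rw [abs_le]
    constructor <;> linarith only [hHn, t1.1, t1.2, t2.1, t2.2, t3.1, t3.2, t4.1, t4.2, t5.1,
      t5.2, t6.1, t6.2, t7.1, t7.2]
  obtain ⟨L₂, hL₂, bL₂⟩ : ∃ L₂, L₂ = z * l * r + (5 * z * v₄ * vx * k + 2 * z' * v₅ * k) * a₁
      - 2 * z' * l * k * b₁ ∧ |L₂| ≤ 40 * H ^ 4 * n := by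
    refine ⟨_, rfl, ?_⟩
    have t1 := abs_le.1 (mono z l 1 1 r n bz bl b1 b1 hr)
    have t2 := abs_le.1 (mono z v₄ vx k a₁ n bz b4 bvx bk ha₁)
    have t3 := abs_le.1 (mono z' v₅ k 1 a₁ n bz' b5 bk b1 ha₁)
    have t4 := abs_le.1 (mono z' l k 1 b₁ n bz' bl bk b1 hb₁)
    have hHn : 0 ≤ H ^ 4 * n := by positivity
    rw [abs_le]
    constructor <;> linarith only [hHn, t1.1, t1.2, t2.1, t2.2, t3.1, t3.2, t4.1, t4.2]
  obtain ⟨L₃, hL₃, bL₃⟩ : ∃ L₃, L₃ = z ^ 2 * (5 / 2 * v₄ * w * a₁ ^ 2 - 5 * v₄ * vx * a₁ * r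
        - 10 * v₃ * vx * a * a₁ ^ 2)
      - 2 * z * z' * (v₅ * a₁ * r - l * r * b₁ + 5 / 2 * v₄ * a * a₁ ^ 2)
      ∧ |L₃| ≤ 40 * H ^ 4 * n ^ 2 := by
    refine ⟨_, rfl, ?_⟩
    have t1 := abs_le.1 (mono (z * z) v₄ w 1 (a₁ * a₁) _ bzz b4 bw b1 (quad _ _ ha₁ ha₁))
    have t2 := abs_le.1 (mono (z * z) v₄ vx 1 (a₁ * r) _ bzz b4 bvx b1 (quad _ _ ha₁ hr))
    have t3 := abs_le.1 (mono (z * z) v₃ vx a (a₁ * a₁) _ bzz b3 bvx ba (quad _ _ ha₁ ha₁))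
    have t4 := abs_le.1 (mono (z * z') v₅ 1 1 (a₁ * r) _ bzz' b5 b1 b1 (quad _ _ ha₁ hr))
    have t5 := abs_le.1 (mono (z * z') l 1 1 (r * b₁) _ bzz' bl b1 b1 (quad _ _ hr hb₁))
    have t6 := abs_le.1 (mono (z * z') v₄ a 1 (a₁ * a₁) _ bzz' b4 ba b1 (quad _ _ ha₁ ha₁))
    have hHn : 0 ≤ H ^ 4 * n ^ 2 := by positivity
    rw [abs_le]
    constructor <;> linarith only [hHn, t1.1, t1.2, t2.1, t2.2, t3.1, t3.2, t4.1, t4.2, t5.1, t5.2, t6.1, t6.2]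
  have expand : z ^ 2 * (5 / 2 * v₄ * w * a₁ ^ 2 - v₅ * A * e - 5 * v₄ * vx * a₁ * e
          - κ * B * A + l * (e * B + A ^ 2)
          - 5 / 2 * (4 * v₃ * vx * a * a₁ ^ 2 + 2 * v₄ * a * a₁ * A))
        - 2 * z * z' * (v₅ * a₁ * e + κ * b₁ * A - l * (e * b₁ + a₁ * A)
          + 5 / 2 * v₄ * a * a₁ ^ 2)
      = -((v₅ * m)) * (z * A) ^ 2 + l * (z * A) ^ 2 + l * (m * (z * A) * (z * B)) - l * (k * (z * B) ^ 2)
        + (z * A) * L₁ + (z * B) * L₂ + L₃ := by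
    rw [he, hL₁, hL₂, hL₃]
    linear_combination (z ^ 2 * A * B) * hk
  have sqle : ∀ L, |L| ≤ (40 * H ^ 4) * n → L ^ 2 ≤ (40 * H ^ 4) ^ 2 * n ^ 2 := by
    intro L hL
    rw [← mul_pow, ← sq_abs L]
    exact pow_le_pow_left₀ (abs_nonneg _) hL 2
  have y1 : (z * A) * L₁ ≤ q / 4 * (z * A) ^ 2 + (40 * H ^ 4) ^ 2 / q * n ^ 2 := by
    have h : q / 4 * (z * A) ^ 2 + L₁ ^ 2 / q - (z * A) * L₁ = (q * (z * A) / 2 - L₁) ^ 2 / q := by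
      field_simp; ring
    have h' : 0 ≤ (q * (z * A) / 2 - L₁) ^ 2 / q := by positivity
    have h'' : L₁ ^ 2 / q ≤ (40 * H ^ 4) ^ 2 / q * n ^ 2 := by
      rw [div_mul_eq_mul_div]; gcongr; exact sqle _ bL₁
    linarith only [h, h', h'']
  have y2 : (z * B) * L₂ ≤ l * k₀ / 4 * (z * B) ^ 2 + (40 * H ^ 4) ^ 2 / (l * k₀) * n ^ 2 := by
    have h : l * k₀ / 4 * (z * B) ^ 2 + L₂ ^ 2 / (l * k₀) - (z * B) * L₂
        = (l * k₀ * (z * B) / 2 - L₂) ^ 2 / (l * k₀) := by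
      field_simp; ring
    have h' : 0 ≤ (l * k₀ * (z * B) / 2 - L₂) ^ 2 / (l * k₀) := by positivity
    have h'' : L₂ ^ 2 / (l * k₀) ≤ (40 * H ^ 4) ^ 2 / (l * k₀) * n ^ 2 := by
      rw [div_mul_eq_mul_div]; gcongr; exact sqle _ bL₂
    linarith only [h, h', h'']
  have y3 : m * (z * A) * (z * B) ≤ k₀ / 4 * (z * B) ^ 2 + H ^ 2 / k₀ * (z * A) ^ 2 := by
    have h : k₀ / 4 * (z * B) ^ 2 + m ^ 2 / k₀ * (z * A) ^ 2 - m * (z * A) * (z * B)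
        = (k₀ * (z * B) / 2 - m * (z * A)) ^ 2 / k₀ := by
      field_simp; ring
    have h' : 0 ≤ (k₀ * (z * B) / 2 - m * (z * A)) ^ 2 / k₀ := by positivity
    have h'' : m ^ 2 / k₀ * (z * A) ^ 2 ≤ H ^ 2 / k₀ * (z * A) ^ 2 := by
      have : m ^ 2 ≤ H ^ 2 := by
        rw [← sq_abs m]; exact pow_le_pow_left₀ (abs_nonneg _) bm 2
      gcongr
    linarith only [h, h', h'']
  have y4 : l * (m * (z * A) * (z * B)) ≤ l * k₀ / 4 * (z * B) ^ 2 + q / 4 * (z * A) ^ 2 := by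
    have h1 := mul_le_mul_of_nonneg_left y3 hl0.le
    have h2 : l * (H ^ 2 / k₀) ≤ q / 4 := by
      calc l * (H ^ 2 / k₀) ≤ q * k₀ / (4 * H ^ 2) * (H ^ 2 / k₀) := by gcongr
        _ = q / 4 := by field_simp
    have h3 := mul_le_mul_of_nonneg_right h2 (sq_nonneg (z * A))
    linarith only [h1, h2, h3]
  have y5 : l * (k₀ * (z * B) ^ 2) ≤ l * (k * (z * B) ^ 2) := by gcongr
  have y6 : q * (z * A) ^ 2 ≤ (v₅ * m) * (z * A) ^ 2 := by gcongr
  have y7 : l * (z * A) ^ 2 ≤ q / 4 * (z * A) ^ 2 := by gcongr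
  have y8 : 0 ≤ q / 4 * (z * A) ^ 2 := by positivity
  have y9 := (abs_le.1 bL₃).2
  rw [expand]
  linarith only [y1, y2, y4, y5, y6, y7, y8, y9]

/-- Coercivity of the energy form behind the regularity estimate: for a small weight `l`, the
mixed energy dissipates the second derivative of the density variable up to lower order. -/
theorem exists_energy_dissipation {μ κ v₀ v₁ M : ℝ} (hμ : 0 < μ) (hκ : 0 < κ) (hv₀ : 0 < v₀)
    (hv₁ : v₀ ≤ v₁) (hM : 0 ≤ M) :
    ∃ l > 0, ∃ c > 0, ∃ K > 0, ∀ v vx w a a₁ b₁ A B r e z z' n : ℝ,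
      v₀ ≤ v → v ≤ v₁ → |vx| ≤ M → |w| ≤ M → |a| ≤ M → |z| ≤ 1 → |z'| ≤ 1 →
      |a₁| ≤ n → |b₁| ≤ n → |r| ≤ n → e = μ / v * A - κ / v ^ 5 * B + r →
      z ^ 2 * (5 / 2 * v ^ 4 * w * a₁ ^ 2 - v ^ 5 * A * e - 5 * v ^ 4 * vx * a₁ * e - κ * B * A
          + l * (e * B + A ^ 2)
          - 5 / 2 * (4 * v ^ 3 * vx * a * a₁ ^ 2 + 2 * v ^ 4 * a * a₁ * A))
        - 2 * z * z' * (v ^ 5 * a₁ * e + κ * b₁ * A - l * (e * b₁ + a₁ * A)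
          + 5 / 2 * v ^ 4 * a * a₁ ^ 2)
        ≤ -(c * (z * B) ^ 2) + K * n ^ 2 := by
  have hv₁0 : 0 < v₁ := hv₀.trans_le hv₁
  set q := μ * v₀ ^ 4 with hq
  set k₀ := κ / v₁ ^ 5 with hk₀
  set m₁ := μ / v₀ with hm₁
  set k₁ := κ / v₀ ^ 5 with hk₁
  have hq0 : 0 < q := by positivity
  have hk₀0 : 0 < k₀ := by positivity
  have hm₁0 : 0 < m₁ := by positivity
  have hk₁0 : 0 < k₁ := by positivity
  have hp3 : 0 < v₁ ^ 3 := by positivity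
  have hp4 : 0 < v₁ ^ 4 := by positivity
  have hp5 : 0 < v₁ ^ 5 := by positivity
  set H := 1 + v₁ ^ 3 + v₁ ^ 4 + v₁ ^ 5 + m₁ + k₁ + M + κ + q with hH
  have hH1 : 1 ≤ H := by linarith
  have hH0 : 0 < H := by linarith
  set l := min (q / 4) (q * k₀ / (4 * H ^ 2)) with hl
  have hl0 : 0 < l := lt_min (by positivity) (by positivity)
  have hl1 : l ≤ q / 4 := min_le_left _ _
  have hl2 : l ≤ q * k₀ / (4 * H ^ 2) := min_le_right _ _
  refine ⟨l, hl0, l * k₀ / 2, by positivity, (40 * H ^ 4) ^ 2 / q + (40 * H ^ 4) ^ 2 / (l * k₀) + (40 * H ^ 4), by positivity, ?_⟩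
  intro v vx w a a₁ b₁ A B r e z z' n hv0 hv1 hvx hw ha hz hz' ha₁ hb₁ hr he
  have hvp : 0 < v := hv₀.trans_le hv0
  have hn : 0 ≤ n := (abs_nonneg _).trans hr
  set m := μ / v with hm
  set k := κ / v ^ 5 with hk
  have e1 : v ^ 5 * m = μ * v ^ 4 := by rw [hm]; field_simp
  have e2 : v ^ 5 * k = κ := by rw [hk]; field_simp
  have bl : |l| ≤ H := by rw [abs_of_pos hl0]; linarith
  have bκ : |κ| ≤ H := by rw [abs_of_pos hκ]; linarith
  have b3 : |v ^ 3| ≤ H := by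
    rw [abs_of_pos (by positivity)]
    have : v ^ 3 ≤ v₁ ^ 3 := by gcongr
    linarith
  have b4 : |v ^ 4| ≤ H := by
    rw [abs_of_pos (by positivity)]
    have : v ^ 4 ≤ v₁ ^ 4 := by gcongr
    linarith
  have b5 : |v ^ 5| ≤ H := by
    rw [abs_of_pos (by positivity)]
    have : v ^ 5 ≤ v₁ ^ 5 := by gcongr
    linarith
  have bm : |m| ≤ H := by
    rw [abs_of_pos (by positivity)]
    have : m ≤ m₁ := by rw [hm, hm₁]; gcongr
    linarith
  have bk : |k| ≤ H := by
    rw [abs_of_pos (by positivity)]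
    have : k ≤ k₁ := by rw [hk, hk₁]; gcongr
    linarith
  have kk : k₀ ≤ k := by rw [hk, hk₀]; gcongr
  have hq4 : q ≤ μ * v ^ 4 := by rw [hq]; gcongr
  have bvx : |vx| ≤ H := by linarith
  have bw : |w| ≤ H := by linarith
  have ba : |a| ≤ H := by linarith
  have b1 : |(1:ℝ)| ≤ H := by rw [abs_one]; exact hH1
  exact energy_form_le hH0 hq0 hk₀0 hl0 hl1 hl2 b1 bl bκ b3 b4 b5 bm bk bvx bw ba hz hz' hn ha₁ hb₁
    hr e2 kk (e1 ▸ hq4) he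

/-- Density of the mixed energy, weighted by `(1 - x / R)²`. -/
noncomputable def mixedEnergy (κ l R : ℝ) (a b v : ℝ → ℝ → ℝ) (x t : ℝ) : ℝ :=
  (1 - x / R) ^ 2 *
    (1 / 2 * (v x t ^ 5 * pdx a x t ^ 2 + κ * pdx b x t ^ 2) - l * (pdx a x t * pdx b x t))

/-- Flux of the mixed energy, weighted by `(1 - x / R)²`. -/
noncomputable def mixedFlux (κ l R : ℝ) (a b v : ℝ → ℝ → ℝ) (x t : ℝ) : ℝ :=
  (1 - x / R) ^ 2 *
    (v x t ^ 5 * pdx a x t * pdt a x t + κ * pdx b x t * pdt b x t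
    - l * (pdt a x t * pdx b x t + pdx a x t * pdt b x t)
    + 5 / 2 * v x t ^ 4 * a x t * pdx a x t ^ 2)

section MixedEnergy

variable {a b v : ℝ → ℝ → ℝ}

theorem contDiff_mixedEnergy (κ l R : ℝ) (ha : ContDiff ℝ (⊤ : ℕ∞) (Function.uncurry a))
    (hb : ContDiff ℝ (⊤ : ℕ∞) (Function.uncurry b))
    (hv : ContDiff ℝ (⊤ : ℕ∞) (Function.uncurry v)) :
    ContDiff ℝ (⊤ : ℕ∞) (Function.uncurry (mixedEnergy κ l R a b v)) := by
  have hax := contDiff_pdx ha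
  have hbx := contDiff_pdx hb
  have hw : ContDiff ℝ (⊤ : ℕ∞) fun z : ℝ × ℝ => (1 - z.1 / R) ^ 2 := by fun_prop
  exact hw.mul (((contDiff_const.mul (((hv.pow 5).mul (hax.pow 2)).add
      (contDiff_const.mul (hbx.pow 2)))).sub (contDiff_const.mul (hax.mul hbx))))

theorem contDiff_mixedFlux (κ l R : ℝ) (ha : ContDiff ℝ (⊤ : ℕ∞) (Function.uncurry a))
    (hb : ContDiff ℝ (⊤ : ℕ∞) (Function.uncurry b))
    (hv : ContDiff ℝ (⊤ : ℕ∞) (Function.uncurry v)) :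
    ContDiff ℝ (⊤ : ℕ∞) (Function.uncurry (mixedFlux κ l R a b v)) := by
  have hax := contDiff_pdx ha
  have hbx := contDiff_pdx hb
  have hat' := contDiff_pdt ha
  have hbt' := contDiff_pdt hb
  have hw : ContDiff ℝ (⊤ : ℕ∞) fun z : ℝ × ℝ => (1 - z.1 / R) ^ 2 := by fun_prop
  exact hw.mul ((((((hv.pow 5).mul hax).mul hat').add ((contDiff_const.mul hbx).mul hbt')).sub
      (contDiff_const.mul ((hat'.mul hbx).add (hax.mul hbt')))).add
      (((contDiff_const.mul (hv.pow 4)).mul ha).mul (hax.pow 2)))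

variable {κ l R : ℝ}

theorem pdt_mixedEnergy (ha : ContDiff ℝ (⊤ : ℕ∞) (Function.uncurry a))
    (hb : ContDiff ℝ (⊤ : ℕ∞) (Function.uncurry b))
    (hv : ContDiff ℝ (⊤ : ℕ∞) (Function.uncurry v)) (x t : ℝ) :
    pdt (mixedEnergy κ l R a b v) x t = (1 - x / R) ^ 2 *
      (1 / 2 * (5 * v x t ^ 4 * pdt v x t * pdx a x t ^ 2
        + v x t ^ 5 * (2 * pdx a x t * pdx (pdt a) x t)
        + κ * (2 * pdx b x t * pdx (pdt b) x t))
        - l * (pdx (pdt a) x t * pdx b x t + pdx a x t * pdx (pdt b) x t)) := by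
  have hax := contDiff_pdx ha
  have hbx := contDiff_pdx hb
  rw [pdx_pdt_comm ha, pdx_pdt_comm hb]
  have d1 := hasDerivAt_pdt hv x t
  have d2 := hasDerivAt_pdt hax x t
  have d3 := hasDerivAt_pdt hbx x t
  have d := ((((((d1.fun_pow 5).fun_mul (d2.fun_pow 2)).fun_add
    ((d3.fun_pow 2).const_mul κ)).const_mul (1 / 2)).fun_sub
    ((d2.fun_mul d3).const_mul l)).const_mul ((1 - x / R) ^ 2))
  refine d.deriv.trans ?_
  push_cast
  ring

theorem pdx_mixedFlux (ha : ContDiff ℝ (⊤ : ℕ∞) (Function.uncurry a))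
    (hb : ContDiff ℝ (⊤ : ℕ∞) (Function.uncurry b))
    (hv : ContDiff ℝ (⊤ : ℕ∞) (Function.uncurry v)) (x t : ℝ) :
    pdx (mixedFlux κ l R a b v) x t = (1 - x / R) ^ 2 *
      (5 * v x t ^ 4 * pdx v x t * pdx a x t * pdt a x t + v x t ^ 5 * pdx (pdx a) x t * pdt a x t
        + v x t ^ 5 * pdx a x t * pdx (pdt a) x t
        + κ * (pdx (pdx b) x t * pdt b x t + pdx b x t * pdx (pdt b) x t)
        - l * (pdx (pdt a) x t * pdx b x t + pdt a x t * pdx (pdx b) x t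
          + pdx (pdx a) x t * pdt b x t + pdx a x t * pdx (pdt b) x t)
        + 5 / 2 * (4 * v x t ^ 3 * pdx v x t * a x t * pdx a x t ^ 2
          + v x t ^ 4 * pdx a x t * pdx a x t ^ 2
          + 2 * v x t ^ 4 * a x t * pdx a x t * pdx (pdx a) x t))
      + 2 * (1 - x / R) * (-(1 / R)) *
      (v x t ^ 5 * pdx a x t * pdt a x t + κ * pdx b x t * pdt b x t
        - l * (pdt a x t * pdx b x t + pdx a x t * pdt b x t)
        + 5 / 2 * v x t ^ 4 * a x t * pdx a x t ^ 2) := by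
  have hax := contDiff_pdx ha
  have hbx := contDiff_pdx hb
  have hat' := contDiff_pdt ha
  have hbt' := contDiff_pdt hb
  have d0 : HasDerivAt (fun y : ℝ => 1 - y / R) (-(1 / R)) x := by
    simpa using ((hasDerivAt_id x).div_const R).const_sub 1
  have d1 := hasDerivAt_pdx hv x t
  have d2 := hasDerivAt_pdx hax x t
  have d3 := hasDerivAt_pdx hbx x t
  have d4 := hasDerivAt_pdx hat' x t
  have d5 := hasDerivAt_pdx hbt' x t
  have d6 := hasDerivAt_pdx ha x t
  have d := (d0.fun_pow 2).fun_mul (((((((d1.fun_pow 5).fun_mul d2).fun_mul d4).fun_add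
    ((d3.const_mul κ).fun_mul d5)).fun_sub
    (((d4.fun_mul d3).fun_add (d2.fun_mul d5)).const_mul l)).fun_add
    ((((d1.fun_pow 4).const_mul (5 / 2)).fun_mul d6).fun_mul (d2.fun_pow 2))))
  refine d.deriv.trans ?_
  push_cast
  ring

end MixedEnergy

/-- Weighted space-time bound for the second derivative of the density variable in the linearised
system, uniform in the length `R` of the interval. -/
theorem exists_weighted_dissipation_bound {a b v N : ℝ → ℝ → ℝ} {μ κ v₀ v₁ M T : ℝ}
    (ha : ContDiff ℝ (⊤ : ℕ∞) (Function.uncurry a)) (hb : ContDiff ℝ (⊤ : ℕ∞) (Function.uncurry b))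
    (hv : ContDiff ℝ (⊤ : ℕ∞) (Function.uncurry v)) (hN : Continuous (Function.uncurry N))
    (hμ : 0 < μ) (hκ : 0 < κ) (hv₀ : 0 < v₀) (hM : 0 ≤ M) (hT : 0 < T)
    (hbt : ∀ x > 0, ∀ t ∈ Ioo 0 T, pdt b x t = pdx (pdx a) x t)
    (hat : ∀ x > 0, ∀ t ∈ Ioo 0 T,
      (pdt a x t - μ / v x t * pdx (pdx a) x t + κ / v x t ^ 5 * pdx (pdx b) x t) ^ 2 ≤ N x t)
    (hvt : ∀ x > 0, ∀ t ∈ Ioo 0 T, |pdt v x t - pdx a x t| ≤ M)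
    (hvx : ∀ x > 0, ∀ t ∈ Ioo 0 T, |pdx v x t| ≤ M)
    (haM : ∀ x > 0, ∀ t ∈ Ioo 0 T, |a x t| ≤ M)
    (hvv : ∀ x ≥ 0, ∀ t ∈ Icc 0 T, v₀ ≤ v x t ∧ v x t ≤ v₁)
    (haN : ∀ x ≥ 0, ∀ t ∈ Icc 0 T, pdx a x t ^ 2 ≤ N x t)
    (hbN : ∀ x ≥ 0, ∀ t ∈ Icc 0 T, pdx b x t ^ 2 ≤ N x t)
    (hNM : ∀ R ≥ 0, ∀ t ∈ Icc 0 T, ∫ x in (0:ℝ)..R, N x t ≤ M) :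
    ∃ M', ∀ R ≥ 1,
      ∫ t in (0:ℝ)..T, ∫ x in (0:ℝ)..R, ((1 - x / R) * pdx (pdx b) x t) ^ 2 ≤ M' := by
  have hv₁ : v₀ ≤ v₁ := by
    have := hvv 0 le_rfl 0 ⟨le_rfl, hT.le⟩
    linarith
  obtain ⟨l, hl, c, hc, K, hK, key⟩ := exists_energy_dissipation hμ hκ hv₀ hv₁ hM
  have hax := contDiff_pdx ha
  have hbx := contDiff_pdx hb
  have haxx := contDiff_pdx hax
  have hbxx := contDiff_pdx hbx
  have hat' := contDiff_pdt ha
  have hbt' := contDiff_pdt hb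
  set q₀ : ℝ → ℝ := fun t => v 0 t ^ 5 * pdx a 0 t * pdt a 0 t + κ * pdx b 0 t * pdt b 0 t
    - l * (pdt a 0 t * pdx b 0 t + pdx a 0 t * pdt b 0 t) + 5 / 2 * v 0 t ^ 4 * a 0 t * pdx a 0 t ^ 2
    with hq₀
  set K₂ := v₁ ^ 5 / 2 + κ / 2 + l with hK₂
  refine ⟨(K * M * T + 2 * (K₂ * M) - ∫ t in (0:ℝ)..T, q₀ t) / c, fun R hR => ?_⟩
  have hR0 : 0 < R := by linarith
  rw [le_div_iff₀ hc]
  obtain ⟨J, hJ⟩ : ∃ J, J = mixedEnergy κ l R a b v := ⟨_, rfl⟩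
  obtain ⟨Q, hQ⟩ : ∃ Q, Q = mixedFlux κ l R a b v := ⟨_, rfl⟩
  have cJ := contDiff_mixedEnergy κ l R ha hb hv
  have cQ := contDiff_mixedFlux κ l R ha hb hv
  rw [← hJ] at cJ
  rw [← hQ] at cQ
  have green := integral_pdt_sub_pdx cJ cQ R T
  have hz : ∀ x ∈ Icc 0 R, |1 - x / R| ≤ 1 := by
    intro x hx
    have h1 : 0 ≤ x / R := div_nonneg hx.1 hR0.le
    have h2 : x / R ≤ 1 := (div_le_one hR0).2 hx.2
    rw [abs_le]
    constructor <;> linarith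
  have hz' : |-(1 / R)| ≤ 1 := by
    rw [abs_neg, abs_of_pos (by positivity)]
    exact (div_le_one hR0).2 hR
  have point : ∀ t ∈ Ioo 0 T, ∀ x ∈ Ioo 0 R, pdt J x t - pdx Q x t
      ≤ -(c * ((1 - x / R) * pdx (pdx b) x t) ^ 2) + K * N x t := by
    intro t ht x hx
    have hx0 : x ≥ 0 := hx.1.le
    have htI : t ∈ Icc 0 T := ⟨ht.1.le, ht.2.le⟩
    have hNn : 0 ≤ N x t := (sq_nonneg _).trans (haN x hx0 t htI)
    have k := key (v x t) (pdx v x t) (pdt v x t - pdx a x t) (a x t) (pdx a x t) (pdx b x t)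
      (pdx (pdx a) x t) (pdx (pdx b) x t)
      (pdt a x t - μ / v x t * pdx (pdx a) x t + κ / v x t ^ 5 * pdx (pdx b) x t) (pdt a x t)
      (1 - x / R) (-(1 / R)) (√(N x t)) (hvv x hx0 t htI).1 (hvv x hx0 t htI).2 (hvx x hx.1 t ht)
      (hvt x hx.1 t ht) (haM x hx.1 t ht) (hz x ⟨hx0, hx.2.le⟩) hz'
      (abs_le_sqrt (haN x hx0 t htI)) (abs_le_sqrt (hbN x hx0 t htI))
      (abs_le_sqrt (hat x hx.1 t ht)) (by ring)
    rw [sq_sqrt hNn] at k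
    refine le_trans (le_of_eq ?_) k
    rw [hJ, hQ, pdt_mixedEnergy ha hb hv, pdx_mixedFlux ha hb hv, hbt x hx.1 t ht]
    ring
  have cN : ∀ t, Continuous fun x => N x t := fun t =>
    hN.comp (by fun_prop : Continuous fun x : ℝ => (x, t))
  have cB : Continuous fun z : ℝ × ℝ => ((1 - z.2 / R) * pdx (pdx b) z.2 z.1) ^ 2 := by
    have : Continuous fun z : ℝ × ℝ => pdx (pdx b) z.2 z.1 :=
      hbxx.continuous.comp (by fun_prop : Continuous fun z : ℝ × ℝ => (z.2, z.1))
    fun_prop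
  have cB' : ∀ t, Continuous fun x => ((1 - x / R) * pdx (pdx b) x t) ^ 2 := fun t =>
    cB.comp (by fun_prop : Continuous fun x : ℝ => (t, x))
  have cJQ : Continuous fun z : ℝ × ℝ => pdt J z.2 z.1 - pdx Q z.2 z.1 :=
    ((contDiff_pdt cJ).continuous.sub (contDiff_pdx cQ).continuous).comp
      (by fun_prop : Continuous fun z : ℝ × ℝ => (z.2, z.1))
  have cJQ' : ∀ t, Continuous fun x => pdt J x t - pdx Q x t := fun t =>
    cJQ.comp (by fun_prop : Continuous fun x : ℝ => (t, x))
  have cD : Continuous fun t => ∫ x in (0:ℝ)..R, ((1 - x / R) * pdx (pdx b) x t) ^ 2 :=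
    intervalIntegral.continuous_parametric_intervalIntegral_of_continuous'
      (f := fun t x => ((1 - x / R) * pdx (pdx b) x t) ^ 2) cB _ _
  have cE : Continuous fun t => ∫ x in (0:ℝ)..R, (pdt J x t - pdx Q x t) :=
    intervalIntegral.continuous_parametric_intervalIntegral_of_continuous'
      (f := fun t x => pdt J x t - pdx Q x t) cJQ _ _
  have inner : ∀ t ∈ Ioo 0 T, ∫ x in (0:ℝ)..R, (pdt J x t - pdx Q x t)
      ≤ -(c * ∫ x in (0:ℝ)..R, ((1 - x / R) * pdx (pdx b) x t) ^ 2) + K * M := by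
    intro t ht
    have i1 := ((cB' t).const_mul c).neg.intervalIntegrable (μ := volume) 0 R
    have i2 := ((cN t).const_mul K).intervalIntegrable (μ := volume) 0 R
    have h := intervalIntegral.integral_mono_on_of_le_Ioo hR0.le
      ((cJQ' t).intervalIntegrable (μ := volume) 0 R) (i1.add i2) (point t ht)
    rw [intervalIntegral.integral_add i1 i2] at h
    simp only [Pi.neg_apply, intervalIntegral.integral_neg,
      intervalIntegral.integral_const_mul] at h
    have h2 := mul_le_mul_of_nonneg_left (hNM R hR0.le t ⟨ht.1.le, ht.2.le⟩) hK.le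
    linarith
  have outer : ∫ t in (0:ℝ)..T, ∫ x in (0:ℝ)..R, (pdt J x t - pdx Q x t)
      ≤ -(c * ∫ t in (0:ℝ)..T, ∫ x in (0:ℝ)..R, ((1 - x / R) * pdx (pdx b) x t) ^ 2)
        + K * M * T := by
    have i1 := (cD.const_mul c).neg.intervalIntegrable (μ := volume) 0 T
    have i2 := (continuous_const (y := K * M)).intervalIntegrable (μ := volume) 0 T
    have h := intervalIntegral.integral_mono_on_of_le_Ioo hT.le
      (cE.intervalIntegrable (μ := volume) 0 T) (i1.add i2) inner
    rw [intervalIntegral.integral_add i1 i2] at h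
    simp only [Pi.neg_apply, intervalIntegral.integral_neg,
      intervalIntegral.integral_const_mul, intervalIntegral.integral_const, smul_eq_mul,
      sub_zero] at h
    linarith
  have bJ : ∀ t ∈ Icc 0 T, ∀ x ∈ Icc 0 R, |J x t| ≤ K₂ * N x t := by
    intro t ht x hx
    have hv' := hvv x hx.1 t ht
    have h1 := haN x hx.1 t ht
    have h2 := hbN x hx.1 t ht
    have hNn : 0 ≤ N x t := (sq_nonneg _).trans h1
    have hvp : 0 ≤ v x t := hv₀.le.trans hv'.1
    have h3 : v x t ^ 5 * pdx a x t ^ 2 ≤ v₁ ^ 5 * N x t := by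
      have h0 := hv'.2
      have h0' : 0 < v₁ := hv₀.trans_le hv₁
      gcongr
    have h3' : 0 ≤ v x t ^ 5 * pdx a x t ^ 2 := by positivity
    have h4 : κ * pdx b x t ^ 2 ≤ κ * N x t := by gcongr
    have h4' : 0 ≤ κ * pdx b x t ^ 2 := by positivity
    have h5 : |l * (pdx a x t * pdx b x t)| ≤ l * N x t := by
      rw [abs_mul, abs_of_pos hl]
      gcongr
      rw [abs_le]
      constructor <;> nlinarith [sq_nonneg (pdx a x t + pdx b x t), sq_nonneg (pdx a x t - pdx b x t)]
    have h6 : |1 / 2 * (v x t ^ 5 * pdx a x t ^ 2 + κ * pdx b x t ^ 2)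
        - l * (pdx a x t * pdx b x t)| ≤ K₂ * N x t := by
      have := abs_le.1 h5
      rw [abs_le, hK₂]
      constructor <;> linarith
    have h7 : |(1 - x / R) ^ 2| ≤ 1 := by
      rw [abs_pow]
      exact pow_le_one₀ (abs_nonneg _) (hz x hx)
    rw [hJ, mixedEnergy, abs_mul]
    calc _ ≤ 1 * (K₂ * N x t) := mul_le_mul h7 h6 (abs_nonneg _) zero_le_one
      _ = _ := one_mul _
  have bJ' : ∀ t ∈ Icc 0 T, |∫ x in (0:ℝ)..R, J x t| ≤ K₂ * M := by
    intro t ht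
    have hK₂0 : 0 ≤ K₂ := by
      have : 0 < v₁ := hv₀.trans_le hv₁
      positivity
    have h := intervalIntegral.norm_integral_le_of_norm_le (μ := volume) hR0.le
      (f := fun x => J x t) (g := fun x => K₂ * N x t)
      (ae_of_all _ fun x hx => bJ t ht x ⟨hx.1.le, hx.2⟩)
      (((cN t).const_mul K₂).intervalIntegrable 0 R)
    rw [intervalIntegral.integral_const_mul] at h
    exact h.trans (mul_le_mul_of_nonneg_left (hNM R hR0.le t ht) hK₂0)
  have eQ : ∫ t in (0:ℝ)..T, (Q R t - Q 0 t) = -∫ t in (0:ℝ)..T, q₀ t := by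
    rw [← intervalIntegral.integral_neg]
    refine intervalIntegral.integral_congr fun t _ => ?_
    simp only [hQ, hq₀, mixedFlux, div_self hR0.ne']
    ring
  have eJ : ∫ x in (0:ℝ)..R, (J x T - J x 0)
      = (∫ x in (0:ℝ)..R, J x T) - ∫ x in (0:ℝ)..R, J x 0 :=
    intervalIntegral.integral_sub ((continuous_of_contDiff_left cJ T).intervalIntegrable _ _)
      ((continuous_of_contDiff_left cJ 0).intervalIntegrable _ _)
  rw [eQ, eJ] at green
  have j1 := abs_le.1 (bJ' T ⟨hT.le, le_rfl⟩)
  have j2 := abs_le.1 (bJ' 0 ⟨le_rfl, hT.le⟩)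
  rw [green] at outer
  linarith

/-- A continuous function whose weighted squares have uniformly bounded integrals is square
integrable on the half-strip. -/
theorem integrable_sq_of_weighted_bound {g : ℝ → ℝ → ℝ} (hg : Continuous (Function.uncurry g))
    {T M : ℝ} (hT : 0 < T)
    (h : ∀ R ≥ 1, ∫ t in (0:ℝ)..T, ∫ x in (0:ℝ)..R, ((1 - x / R) * g x t) ^ 2 ≤ M) :
    Integrable (fun z : ℝ × ℝ => g z.2 z.1 ^ 2)
      ((volume.restrict (Ioc 0 T)).prod (volume.restrict (Ioi 0))) := by
  have cg : Continuous fun z : ℝ × ℝ => g z.2 z.1 :=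
    hg.comp (by fun_prop : Continuous fun z : ℝ × ℝ => (z.2, z.1))
  have hset : ∀ n : ℕ, ((volume.restrict (Ioc 0 T)).prod (volume.restrict (Ioi (0:ℝ)))).restrict
      (univ ×ˢ Iic (n : ℝ)) = (volume.restrict (Ioc 0 T)).prod (volume.restrict (Ioc 0 (n : ℝ))) := by
    intro n
    rw [← Measure.prod_restrict, Measure.restrict_univ, Measure.restrict_restrict measurableSet_Iic,
      inter_comm, Ioi_inter_Iic]
  have hint : ∀ (R : ℝ) {f : ℝ × ℝ → ℝ}, Continuous f → Integrable f
      ((volume.restrict (Ioc 0 T)).prod (volume.restrict (Ioc 0 R))) := by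
    intro R f hf
    rw [Measure.prod_restrict]
    exact (hf.continuousOn.integrableOn_compact (isCompact_Icc.prod isCompact_Icc)).mono_set
      (Set.prod_mono Ioc_subset_Icc_self Ioc_subset_Icc_self)
  have hcov : AECover ((volume.restrict (Ioc 0 T)).prod (volume.restrict (Ioi (0:ℝ)))) atTop
      (fun n : ℕ => (univ : Set ℝ) ×ˢ Iic (n : ℝ)) := by
    constructor
    · refine ae_of_all _ fun z => ?_
      filter_upwards [eventually_ge_atTop ⌈z.2⌉₊] with n hn
      exact ⟨mem_univ _, (Nat.le_ceil z.2).trans (Nat.cast_le.2 hn)⟩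
    · intro n
      exact MeasurableSet.univ.prod measurableSet_Iic
  refine hcov.integrable_of_integral_bounded_of_nonneg_ae (4 * M) (fun n => ?_)
    (ae_of_all _ fun z => sq_nonneg _) ?_
  · rw [IntegrableOn, hset]
    exact hint _ (cg.pow 2)
  · filter_upwards [eventually_ge_atTop 1] with n hn
    have hn' : (1:ℝ) ≤ n := by exact_mod_cast hn
    rw [hset]
    set R : ℝ := 2 * n with hR
    have hR0 : 0 < R := by linarith
    have cw : Continuous fun z : ℝ × ℝ => ((1 - z.2 / R) * g z.2 z.1) ^ 2 := by fun_prop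
    have hmono : (volume.restrict (Ioc 0 T)).prod (volume.restrict (Ioc 0 (n : ℝ)))
        ≤ (volume.restrict (Ioc 0 T)).prod (volume.restrict (Ioc 0 R)) := by
      rw [Measure.prod_restrict, Measure.prod_restrict]
      exact Measure.restrict_mono (Set.prod_mono le_rfl (Ioc_subset_Ioc_right (by linarith))) le_rfl
    calc ∫ z, g z.2 z.1 ^ 2 ∂(volume.restrict (Ioc 0 T)).prod (volume.restrict (Ioc 0 (n : ℝ)))
        ≤ ∫ z, 4 * ((1 - z.2 / R) * g z.2 z.1) ^ 2
            ∂(volume.restrict (Ioc 0 T)).prod (volume.restrict (Ioc 0 (n : ℝ))) := by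
          refine integral_mono_ae (hint _ (cg.pow 2)) (hint _ (cw.const_mul 4)) ?_
          rw [Measure.prod_restrict]
          refine (ae_restrict_mem (measurableSet_Ioc.prod measurableSet_Ioc)).mono fun z hz => ?_
          have h1 : z.2 / R ≤ 1 / 2 := by
            rw [div_le_iff₀ hR0]
            have := hz.2.2
            linarith
          have h2 : (1 / 2) ^ 2 ≤ (1 - z.2 / R) ^ 2 :=
            pow_le_pow_left₀ (by norm_num) (by linarith) 2
          have h3 := mul_le_mul_of_nonneg_right h2 (sq_nonneg (g z.2 z.1))
          simp only [mul_pow]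
          linarith
      _ ≤ ∫ z, 4 * ((1 - z.2 / R) * g z.2 z.1) ^ 2
            ∂(volume.restrict (Ioc 0 T)).prod (volume.restrict (Ioc 0 R)) :=
          integral_mono_measure hmono (ae_of_all _ fun z => by positivity)
            (hint _ (cw.const_mul 4))
      _ = 4 * ∫ t in (0:ℝ)..T, ∫ x in (0:ℝ)..R, ((1 - x / R) * g x t) ^ 2 := by
          rw [integral_const_mul, integral_prod _ (hint _ cw), intervalIntegral.integral_of_le hT.le]
          simp_rw [intervalIntegral.integral_of_le hR0.le]
      _ ≤ 4 * M := by
          have := h R (by linarith)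
          linarith

theorem stronglyMeasurable_sqnorm {g : ℝ → ℝ → ℝ} (hg : Continuous (Function.uncurry g)) :
    StronglyMeasurable (sqnorm g) := by
  have cg : Continuous fun z : ℝ × ℝ => g z.2 z.1 ^ 2 :=
    (hg.comp (by fun_prop : Continuous fun z : ℝ × ℝ => (z.2, z.1))).pow 2
  exact cg.stronglyMeasurable.integral_prod_right (ν := volume.restrict (Ioi 0))

theorem intervalIntegrable_sqnorm_of_weighted_bound {g : ℝ → ℝ → ℝ}
    (hg : Continuous (Function.uncurry g)) {T M : ℝ} (hT : 0 < T)
    (h : ∀ R ≥ 1, ∫ t in (0:ℝ)..T, ∫ x in (0:ℝ)..R, ((1 - x / R) * g x t) ^ 2 ≤ M) :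
    IntervalIntegrable (sqnorm g) volume 0 T := by
  rw [intervalIntegrable_iff_integrableOn_Ioc_of_le hT.le]
  exact (integrable_sq_of_weighted_bound hg hT h).integral_prod_left

theorem sqnorm_nonneg (f : ℝ → ℝ → ℝ) (t : ℝ) : 0 ≤ sqnorm f t :=
  integral_nonneg fun _ => sq_nonneg _

theorem sqnorm_le_of_sqrt_Hsq_le {f : ℝ → ℝ → ℝ} {k j : ℕ} {t ε : ℝ} (hε : 0 ≤ ε)
    (h : √(Hsq k f t) ≤ ε) (hj : j ≤ k) : sqnorm (pdx^[j] f) t ≤ ε ^ 2 :=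
  (Finset.single_le_sum (f := fun j => sqnorm (pdx^[j] f) t) (fun _ _ => sqnorm_nonneg _ _)
    (Finset.mem_range.2 (Nat.lt_succ_of_le hj))).trans ((Real.sqrt_le_left hε).1 h)

theorem monotone_profile_mem_Icc {V : ℝ → ℝ} {vm vp c B : ℝ} (hc : 0 < c) (hV : Monotone V)
    (hm : ∀ ξ ≤ (0:ℝ), |V ξ - vm| ≤ B * exp (c * ξ))
    (hp : ∀ ξ ≥ (0:ℝ), |V ξ - vp| ≤ B * exp (-(c * ξ))) (ξ : ℝ) : V ξ ∈ Icc vm vp := by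
  have h1 : Tendsto V atBot (nhds vm) := by
    have h : Tendsto (fun ξ => B * exp (c * ξ)) atBot (nhds 0) := by
      simpa using (Real.tendsto_exp_atBot.comp (tendsto_id.const_mul_atBot hc)).const_mul B
    rw [tendsto_iff_norm_sub_tendsto_zero]
    exact squeeze_zero' (Eventually.of_forall fun _ => norm_nonneg _)
      ((eventually_le_atBot 0).mono fun ξ hξ => hm ξ hξ) h
  have h2 : Tendsto V atTop (nhds vp) := by
    have h : Tendsto (fun ξ => B * exp (-(c * ξ))) atTop (nhds 0) := by
      simpa using (Real.tendsto_exp_neg_atTop_nhds_zero.comp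
        (tendsto_id.const_mul_atTop hc)).const_mul B
    rw [tendsto_iff_norm_sub_tendsto_zero]
    exact squeeze_zero' (Eventually.of_forall fun _ => norm_nonneg _)
      ((eventually_ge_atTop 0).mono fun ξ hξ => hp ξ hξ) h
  exact ⟨hV.le_of_tendsto h1 ξ, hV.ge_of_tendsto h2 ξ⟩

/-- The spatial derivative of the right-hand side of the momentum equation solved for `ψ_t`. -/
theorem hasDerivAt_momentum {p W w₁ w₂ u₁ f f₁ f₂ g : ℝ → ℝ}
    {μ κ q q₀ w₃ u₂ f₃ g₁ x : ℝ}
    (hW : HasDerivAt W (w₁ x) x) (hw₁ : HasDerivAt w₁ (w₂ x) x) (hw₂ : HasDerivAt w₂ w₃ x)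
    (hu₁ : HasDerivAt u₁ u₂ x) (hf : HasDerivAt f (f₁ x) x) (hf₁ : HasDerivAt f₁ (f₂ x) x)
    (hf₂ : HasDerivAt f₂ f₃ x) (hg : HasDerivAt g g₁ x)
    (hp : HasDerivAt p q (W x + f x)) (hp₀ : HasDerivAt p q₀ (W x))
    (hW0 : W x ≠ 0) (hv0 : W x + f x ≠ 0) {I J : ℝ} (hI : I = (W x + f x)⁻¹) (hJ : J = (W x)⁻¹) :
    HasDerivAt (fun y => μ * g y * (W y + f y)⁻¹ - κ * f₂ y * (W y + f y)⁻¹ ^ 5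
        - p (W y + f y) + p (W y) + κ * w₂ y * ((W y)⁻¹ ^ 5 - (W y + f y)⁻¹ ^ 5)
        + 5 * κ / 2 * (f₁ y ^ 2 + 2 * f₁ y * w₁ y) * (W y + f y)⁻¹ ^ 6
        + 5 * κ / 2 * w₁ y ^ 2 * ((W y)⁻¹ ^ 6 - (W y + f y)⁻¹ ^ 6)
        - μ * u₁ y * f y * (W y + f y)⁻¹ * (W y)⁻¹)
      (μ / (W x + f x) * g₁ - κ / (W x + f x) ^ 5 * f₃ +
        ((-μ * (w₁ x + f₁ x) * I ^ 2) * g x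
        + (5 * κ * (w₁ x + f₁ x) * I ^ 6 + 5 * κ * (f₁ x + w₁ x) * I ^ 6) * f₂ x
        + (-q - 15 * κ * (f₁ x + 2 * w₁ x) * I ^ 7 * (w₁ x + f₁ x)) * f₁ x
        + (-q + q₀
            + 15 * κ * w₁ x * (I ^ 7 * (w₁ x + f₁ x) - J ^ 7 * w₁ x)) * w₁ x
        + (5 * κ * (I ^ 6 * (w₁ x + f₁ x) - J ^ 6 * w₁ x) + 5 * κ * f₁ x * I ^ 6
            + 5 * κ * w₁ x * (J ^ 6 - I ^ 6)) * w₂ x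
        + κ * (J ^ 5 - I ^ 5) * w₃
        + (-μ * f₁ x * I * J + μ * f x * (I ^ 2 * (w₁ x + f₁ x) * J + I * J ^ 2 * w₁ x)) * u₁ x
        + (-μ * f x * I * J) * u₂)) x := by
  have dI := (hW.fun_add hf).fun_inv hv0
  have dJ := hW.fun_inv hW0
  have dp : HasDerivAt (fun y => p (W y + f y)) (q * (w₁ x + f₁ x)) x :=
    HasDerivAt.comp x hp (hW.fun_add hf)
  have dp₀ : HasDerivAt (fun y => p (W y)) (q₀ * w₁ x) x := HasDerivAt.comp x hp₀ hW
  have d := (((((((((hg.const_mul μ).fun_mul dI).fun_sub ((hf₂.const_mul κ).fun_mul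
    (dI.fun_pow 5))).fun_sub dp).fun_add dp₀).fun_add ((hw₂.const_mul κ).fun_mul
    ((dJ.fun_pow 5).fun_sub (dI.fun_pow 5)))).fun_add ((((hf₁.fun_pow 2).fun_add
    ((hf₁.const_mul 2).fun_mul hw₁)).const_mul (5 * κ / 2)).fun_mul (dI.fun_pow 6))).fun_add
    (((hw₁.fun_pow 2).const_mul (5 * κ / 2)).fun_mul
    ((dJ.fun_pow 6).fun_sub (dI.fun_pow 6)))).fun_sub
    ((((hu₁.const_mul μ).fun_mul hf).fun_mul dI).fun_mul dJ))
  refine d.congr_deriv ?_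
  simp only [div_eq_mul_inv, ← inv_pow, neg_mul, ← hI, ← hJ]
  push_cast
  ring

/-- The lower-order terms of the differentiated momentum equation are dominated by any function
that dominates the decaying quantities occurring in them. -/
theorem isBigO_momentum_remainder {ι : Type*} {l : Filter ι}
    {w₁ w₂ w₃ u₁ u₂ f f₁ f₂ g q q₀ I J P : ι → ℝ} {μ κ : ℝ}
    (bw₁ : w₁ =O[l] (1 : ι → ℝ)) (bf : f =O[l] (1 : ι → ℝ))
    (bf₁ : f₁ =O[l] (1 : ι → ℝ)) (bq : q =O[l] (1 : ι → ℝ)) (bq₀ : q₀ =O[l] (1 : ι → ℝ))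
    (bI : I =O[l] (1 : ι → ℝ)) (bJ : J =O[l] (1 : ι → ℝ))
    (dw₁ : w₁ =O[l] P) (dw₂ : w₂ =O[l] P) (dw₃ : w₃ =O[l] P) (du₁ : u₁ =O[l] P)
    (du₂ : u₂ =O[l] P) (df₁ : f₁ =O[l] P) (df₂ : f₂ =O[l] P) (dg : g =O[l] P) :
    (fun z => (-μ * (w₁ z + f₁ z) * I z ^ 2) * g z
        + (5 * κ * (w₁ z + f₁ z) * I z ^ 6 + 5 * κ * (f₁ z + w₁ z) * I z ^ 6) * f₂ z
        + (-q z - 15 * κ * (f₁ z + 2 * w₁ z) * I z ^ 7 * (w₁ z + f₁ z)) * f₁ z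
        + (-q z + q₀ z
            + 15 * κ * w₁ z * (I z ^ 7 * (w₁ z + f₁ z) - J z ^ 7 * w₁ z)) * w₁ z
        + (5 * κ * (I z ^ 6 * (w₁ z + f₁ z) - J z ^ 6 * w₁ z) + 5 * κ * f₁ z * I z ^ 6
            + 5 * κ * w₁ z * (J z ^ 6 - I z ^ 6)) * w₂ z
        + κ * (J z ^ 5 - I z ^ 5) * w₃ z
        + (-μ * f₁ z * I z * J z
            + μ * f z * (I z ^ 2 * (w₁ z + f₁ z) * J z + I z * J z ^ 2 * w₁ z)) * u₁ z
        + (-μ * f z * I z * J z) * u₂ z) =O[l] P := by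
  have bm : ∀ {a b : ι → ℝ}, a =O[l] (1 : ι → ℝ) → b =O[l] (1 : ι → ℝ) →
      (fun z => a z * b z) =O[l] (1 : ι → ℝ) := fun ha hb => by
    simpa [Pi.one_def] using ha.mul hb
  have bp : ∀ {a : ι → ℝ} (n : ℕ), a =O[l] (1 : ι → ℝ) →
      (fun z => a z ^ n) =O[l] (1 : ι → ℝ) := fun n ha => by
    simpa [Pi.one_def] using ha.pow n
  have bc : ∀ c : ℝ, (fun _ => c) =O[l] (1 : ι → ℝ) := fun c =>
    Asymptotics.isBigO_const_const c one_ne_zero l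
  have dm : ∀ {a b : ι → ℝ}, a =O[l] (1 : ι → ℝ) → b =O[l] P →
      (fun z => a z * b z) =O[l] P := fun ha hb => by
    simpa using ha.mul hb
  have bv := bw₁.add bf₁
  have b6 := (bp 6 bJ).sub (bp 6 bI)
  refine ((((((((dm ?_ dg).add (dm ?_ df₂)).add (dm ?_ df₁)).add (dm ?_ dw₁)).add
    (dm ?_ dw₂)).add (dm ?_ dw₃)).add (dm ?_ du₁)).add (dm ?_ du₂))
  · exact bm (bm (bc _) bv) (bp 2 bI)
  · exact (bm (bm (bc _) bv) (bp 6 bI)).add (bm (bm (bc _) (bf₁.add bw₁)) (bp 6 bI))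
  · exact bq.neg_left.sub (bm (bm (bm (bc _) (bf₁.add (bm (bc 2) bw₁))) (bp 7 bI)) bv)
  · exact (bq.neg_left.add bq₀).add
      (bm (bm (bc _) bw₁) ((bm (bp 7 bI) bv).sub (bm (bp 7 bJ) bw₁)))
  · exact ((bm (bc _) ((bm (bp 6 bI) bv).sub (bm (bp 6 bJ) bw₁))).add
      (bm (bm (bc _) bf₁) (bp 6 bI))).add
      (bm (bm (bc _) bw₁) b6)
  · exact bm (bc _) ((bp 5 bJ).sub (bp 5 bI))
  · exact (bm (bm (bm (bc _) bf₁) bI) bJ).add (bm (bm (bc _) bf)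
      ((bm (bm (bp 2 bI) bv) bJ).add (bm (bm bI (bp 2 bJ)) bw₁)))
  · exact bm (bm (bm (bc _) bf) bI) bJ

theorem pdx_congr {f g : ℝ → ℝ → ℝ} {t : ℝ} (h : ∀ x > 0, f x t = g x t) {x : ℝ} (hx : 0 < x) :
    pdx f x t = pdx g x t :=
  EventuallyEq.deriv_eq (mem_of_superset (Ioi_mem_nhds hx) h)

/-- The momentum equation, solved for `ψ_t`. -/
theorem eq_momentum_of_NSKF {p V U : ℝ → ℝ} {φ ψ : ℝ → ℝ → ℝ} {μ κ s α β x t : ℝ}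
    (hV : V (x - s * t + α - β) ≠ 0) (hv : V (x - s * t + α - β) + pdx φ x t ≠ 0)
    (h : pdt ψ x t + deriv p (V (x - s * t + α - β)) * pdx φ x t
        - μ / V (x - s * t + α - β) * pdx (pdx ψ) x t
        + κ * pdx (pdx (pdx φ)) x t / (V (x - s * t + α - β) + pdx φ x t) ^ 5
        + μ * deriv U (x - s * t + α - β) * pdx φ x t / (V (x - s * t + α - β)) ^ 2
      = NSKF p μ κ s α β V U φ ψ x t) :
    pdt ψ x t = μ * pdx (pdx ψ) x t * (V (x - s * t + α - β) + pdx φ x t)⁻¹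
      - κ * pdx (pdx (pdx φ)) x t * (V (x - s * t + α - β) + pdx φ x t)⁻¹ ^ 5
      - p (V (x - s * t + α - β) + pdx φ x t) + p (V (x - s * t + α - β))
      + κ * deriv (deriv V) (x - s * t + α - β)
        * ((V (x - s * t + α - β))⁻¹ ^ 5 - (V (x - s * t + α - β) + pdx φ x t)⁻¹ ^ 5)
      + 5 * κ / 2 * (pdx (pdx φ) x t ^ 2 + 2 * pdx (pdx φ) x t * deriv V (x - s * t + α - β))
        * (V (x - s * t + α - β) + pdx φ x t)⁻¹ ^ 6
      + 5 * κ / 2 * deriv V (x - s * t + α - β) ^ 2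
        * ((V (x - s * t + α - β))⁻¹ ^ 6 - (V (x - s * t + α - β) + pdx φ x t)⁻¹ ^ 6)
      - μ * deriv U (x - s * t + α - β) * pdx φ x t
        * (V (x - s * t + α - β) + pdx φ x t)⁻¹ * (V (x - s * t + α - β))⁻¹ := by
  have key : ∀ {W f g u : ℝ}, W ≠ 0 → W + f ≠ 0 →
      μ / W * g - μ * u * f / W ^ 2 - μ * g * f / ((W + f) * W) + μ * u * f ^ 2 / ((W + f) * W ^ 2)
        = μ * g * (W + f)⁻¹ - μ * u * f * (W + f)⁻¹ * W⁻¹ := by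
    intro W f g u h1 h2
    field_simp
    ring
  have h0 := key (g := pdx (pdx ψ) x t) (u := deriv U (x - s * t + α - β)) hV hv
  unfold NSKF at h
  rw [← sub_eq_zero] at h h0 ⊢
  refine Eq.trans ?_ ((congrArg₂ (fun a b => a + b) h h0).trans (add_zero 0))
  simp only [← inv_pow, div_eq_mul_inv]
  ring

/-- The dissipation `‖φ_xxxx‖²` of a solution near the shock profile is integrable in time. -/
theorem intervalIntegrable_sqnorm_pdx_four {p V U : ℝ → ℝ} {φ ψ : ℝ → ℝ → ℝ}
    {μ κ s c D α β T vm vp : ℝ} (hp : ContDiffOn ℝ (⊤ : ℕ∞) p (Ioi 0))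
    (hμ : 0 < μ) (hκ : 0 < κ) (hc : 0 < c) (hvm : 0 < vm) (hT : 0 < T)
    (hV : ContDiff ℝ (⊤ : ℕ∞) V) (hU : ContDiff ℝ (⊤ : ℕ∞) U) (hVv : ∀ ξ, V ξ ∈ Icc vm vp)
    (hd₁ : ∀ ξ, |deriv V ξ| + |deriv U ξ| ≤ D * exp (-(c * |ξ|)))
    (hd₂ : ∀ ξ, |deriv (deriv V) ξ| + |deriv (deriv U) ξ| ≤ D * exp (-(c * |ξ|)))
    (hd₃ : ∀ ξ, |deriv (deriv (deriv V)) ξ| + |deriv (deriv (deriv U)) ξ| ≤ D * exp (-(c * |ξ|)))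
    (hφ : ContDiff ℝ (⊤ : ℕ∞) (Function.uncurry φ)) (hψ : ContDiff ℝ (⊤ : ℕ∞) (Function.uncurry ψ))
    (hφi : ∀ t ∈ Icc 0 T, ∀ j ≤ 4, IntegrableOn (fun x => (pdx^[j] φ x t) ^ 2) (Ioi 0) ∧
      Tendsto (fun x => pdx^[j] φ x t) atTop (nhds 0))
    (hψi : ∀ t ∈ Icc 0 T, ∀ j ≤ 3, IntegrableOn (fun x => (pdx^[j] ψ x t) ^ 2) (Ioi 0) ∧
      Tendsto (fun x => pdx^[j] ψ x t) atTop (nhds 0))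
    (hv : ∀ x ≥ 0, ∀ t ∈ Icc 0 T, vm / 2 ≤ V (x - s * t + α - β) + pdx φ x t ∧
      V (x - s * t + α - β) + pdx φ x t ≤ 3 / 2 * vp)
    (hmass : ∀ x ∈ Ioi (0:ℝ), ∀ t ∈ Ioo 0 T, pdt φ x t - pdx ψ x t = 0)
    (hmom : ∀ x ∈ Ioi (0:ℝ), ∀ t ∈ Ioo 0 T,
      pdt ψ x t + deriv p (V (x - s * t + α - β)) * pdx φ x t
        - μ / V (x - s * t + α - β) * pdx (pdx ψ) x t
        + κ * pdx (pdx (pdx φ)) x t / (V (x - s * t + α - β) + pdx φ x t) ^ 5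
        + μ * deriv U (x - s * t + α - β) * pdx φ x t / (V (x - s * t + α - β)) ^ 2
      = NSKF p μ κ s α β V U φ ψ x t)
    (hφN : ∀ t ∈ Icc 0 T, ∀ j ≤ 3, sqnorm (pdx^[j] φ) t ≤ 1)
    (hψN : ∀ t ∈ Icc 0 T, ∀ j ≤ 2, sqnorm (pdx^[j] ψ) t ≤ 1) :
    IntervalIntegrable (sqnorm (pdx^[4] φ)) volume 0 T := by
  have hV1 : ContDiff ℝ (⊤ : ℕ∞) (deriv V) := hV.deriv'
  have hV2 : ContDiff ℝ (⊤ : ℕ∞) (deriv (deriv V)) := hV1.deriv'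
  have hU1 : ContDiff ℝ (⊤ : ℕ∞) (deriv U) := hU.deriv'
  have hφ1 := contDiff_pdx hφ
  have hφ2 := contDiff_pdx hφ1
  have hφ3 := contDiff_pdx hφ2
  have hψ1 := contDiff_pdx hψ
  have hψ2 := contDiff_pdx hψ1
  have hVs : ContDiff ℝ (⊤ : ℕ∞) (fun z : ℝ × ℝ => V (z.1 - s * z.2 + α - β)) :=
    hV.comp (by fun_prop)
  have hvs : ContDiff ℝ (⊤ : ℕ∞) (Function.uncurry fun x t => V (x - s * t + α - β) + pdx φ x t) :=
    hVs.add hφ1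
  have shx : ∀ {h : ℝ → ℝ}, ContDiff ℝ (⊤ : ℕ∞) h → ∀ x t,
      HasDerivAt (fun y => h (y - s * t + α - β)) (deriv h (x - s * t + α - β)) x := by
    intro h hh x t
    have h1 := (hh.differentiable (by simp) (x - s * t + α - β)).hasDerivAt
    have h2 : HasDerivAt (fun y => y - s * t + α - β) 1 x :=
      (((hasDerivAt_id x).sub_const (s * t)).add_const α).sub_const β
    exact (HasDerivAt.comp x h1 h2).congr_deriv (mul_one _)
  have sht : ∀ x t, HasDerivAt (fun r => V (x - s * r + α - β))
      (-s * deriv V (x - s * t + α - β)) t := by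
    intro x t
    have h1 := (hV.differentiable (by simp) (x - s * t + α - β)).hasDerivAt
    have h2 : HasDerivAt (fun r => x - s * r + α - β) (-s) t := by
      simpa using (((((hasDerivAt_id t).const_mul s).const_sub x).add_const α).sub_const β)
    exact (HasDerivAt.comp t h1 h2).congr_deriv (mul_comm _ _)
  have pdp : ∀ v > 0, HasDerivAt p (deriv p v) v := fun v hv =>
    ((hp.contDiffAt (Ioi_mem_nhds hv)).differentiableAt (by simp)).hasDerivAt
  have hD : 0 ≤ D := by
    have := (add_nonneg (abs_nonneg _) (abs_nonneg _)).trans (hd₁ 0)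
    simpa using this
  -- exponential decay of the profile at fixed time
  obtain ⟨A, hA0, hA⟩ : ∃ A > 0, ∀ x ≥ 0, ∀ t ∈ Icc 0 T,
      exp (-(c * |x - s * t + α - β|)) ≤ A * exp (-(c * x)) := by
    refine ⟨exp (c * (|s| * T + |α| + |β|)), exp_pos _, fun x _ t ht => ?_⟩
    rw [← exp_add]
    refine exp_le_exp.2 ?_
    have h1 : s * t ≤ |s| * T :=
      (mul_le_mul_of_nonneg_right (le_abs_self s) ht.1).trans
        (mul_le_mul_of_nonneg_left ht.2 (abs_nonneg s))
    have h2 := le_abs_self (x - s * t + α - β)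
    have h3 := neg_abs_le α
    have h4 := le_abs_self β
    have h5 : x - (|s| * T + |α| + |β|) ≤ |x - s * t + α - β| := by linarith
    have := mul_le_mul_of_nonneg_left h5 hc.le
    linarith
  -- pointwise bounds
  have sob : ∀ {f : ℝ → ℝ → ℝ}, ContDiff ℝ (⊤ : ℕ∞) (Function.uncurry f) → ∀ t,
      IntegrableOn (fun x => f x t ^ 2) (Ioi 0) → IntegrableOn (fun x => pdx f x t ^ 2) (Ioi 0) →
      Tendsto (fun x => f x t) atTop (nhds 0) → sqnorm f t ≤ 1 → sqnorm (pdx f) t ≤ 1 →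
      ∀ x ≥ 0, |f x t| ≤ 2 := by
    intro f hf t h1 h2 h3 h4 h5 x hx
    have := sq_le_of_integrableOn_Ioi (fun x => hasDerivAt_pdx hf x t)
      (continuous_of_contDiff_left (contDiff_pdx hf) t) h1 h2 h3 one_pos hx
    simp only [sqnorm] at h4 h5
    refine abs_le_of_sq_le_sq ?_ zero_le_two
    rw [one_mul, inv_one, one_mul] at this
    linarith
  have bφ2 : ∀ x ≥ 0, ∀ t ∈ Icc 0 T, |pdx (pdx φ) x t| ≤ 2 := fun x hx t ht =>
    sob hφ2 t (hφi t ht 2 (by norm_num)).1 (hφi t ht 3 (by norm_num)).1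
      (hφi t ht 2 (by norm_num)).2 (hφN t ht 2 (by norm_num)) (hφN t ht 3 (by norm_num)) x hx
  have bψ1 : ∀ x ≥ 0, ∀ t ∈ Icc 0 T, |pdx ψ x t| ≤ 2 := fun x hx t ht =>
    sob hψ1 t (hψi t ht 1 (by norm_num)).1 (hψi t ht 2 (by norm_num)).1
      (hψi t ht 1 (by norm_num)).2 (hψN t ht 1 (by norm_num)) (hψN t ht 2 (by norm_num)) x hx
  have bV1 : ∀ ξ, |deriv V ξ| ≤ D := fun ξ => by
    have h1 : exp (-(c * |ξ|)) ≤ 1 := exp_le_one_iff.2 (by have := abs_nonneg ξ; nlinarith)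
    have h2 := mul_le_mul_of_nonneg_left h1 hD
    linarith [hd₁ ξ, abs_nonneg (deriv U ξ)]
  obtain ⟨Q, hQ⟩ : ∃ Q, ∀ v ∈ Icc (vm / 2) (3 / 2 * vp), |deriv p v| ≤ Q := by
    have hcont : ContinuousOn (deriv p) (Icc (vm / 2) (3 / 2 * vp)) :=
      (hp.continuousOn_deriv_of_isOpen isOpen_Ioi (by simp)).mono fun v hv =>
        (by linarith [hv.1] : 0 < v)
    exact isCompact_Icc.exists_bound_of_continuousOn hcont
  -- the remainder
  obtain ⟨M, hM⟩ : ∃ M, ∀ x > 0, ∀ t ∈ Ioo 0 T,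
      |pdt (pdx ψ) x t - μ / (V (x - s * t + α - β) + pdx φ x t) * pdx (pdx (pdx ψ)) x t
        + κ / (V (x - s * t + α - β) + pdx φ x t) ^ 5 * pdx (pdx (pdx (pdx φ))) x t|
      ≤ M * (|pdx (pdx φ) x t| + |pdx (pdx (pdx φ)) x t| + |pdx (pdx ψ) x t| + exp (-(c * x))) := by
    obtain ⟨P, hP⟩ : ∃ P : ℝ × ℝ → ℝ, P = fun z => |pdx (pdx φ) z.1 z.2|
      + |pdx (pdx (pdx φ)) z.1 z.2| + |pdx (pdx ψ) z.1 z.2| + exp (-(c * z.1)) := ⟨_, rfl⟩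
    have hP0 : ∀ z, 0 ≤ P z := fun z => by
      rw [hP]
      positivity
    have hPle : ∀ z, |pdx (pdx φ) z.1 z.2| ≤ P z ∧ |pdx (pdx (pdx φ)) z.1 z.2| ≤ P z ∧
        |pdx (pdx ψ) z.1 z.2| ≤ P z ∧ exp (-(c * z.1)) ≤ P z := fun z => by
      have h1 := abs_nonneg (pdx (pdx φ) z.1 z.2)
      have h2 := abs_nonneg (pdx (pdx (pdx φ)) z.1 z.2)
      have h3 := abs_nonneg (pdx (pdx ψ) z.1 z.2)
      have h4 := exp_nonneg (-(c * z.1))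
      simp only [hP]
      refine ⟨?_, ?_, ?_, ?_⟩ <;> linarith
    have bd : ∀ {B : ℝ} {h : ℝ × ℝ → ℝ}, (∀ x > 0, ∀ t ∈ Ioo 0 T, |h (x, t)| ≤ B) →
        h =O[𝓟 (Ioi 0 ×ˢ Ioo 0 T)] (1 : ℝ × ℝ → ℝ) := fun {B h} hb =>
      .of_bound B (eventually_principal.2 fun z hz => by simpa using hb z.1 hz.1 z.2 hz.2)
    have de : ∀ {h : ℝ → ℝ}, (∀ ξ, |h ξ| ≤ D * exp (-(c * |ξ|))) →
        (fun z : ℝ × ℝ => h (z.1 - s * z.2 + α - β)) =O[𝓟 (Ioi 0 ×ˢ Ioo 0 T)] P := by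
      intro h hh
      refine .of_bound (D * A) (eventually_principal.2 fun z hz => ?_)
      have h1 := hA z.1 (le_of_lt hz.1) z.2 ⟨hz.2.1.le, hz.2.2.le⟩
      have h2 := (hPle z).2.2.2
      rw [norm_eq_abs, norm_eq_abs, abs_of_nonneg (hP0 z), mul_assoc]
      exact (hh _).trans (mul_le_mul_of_nonneg_left
        (h1.trans (mul_le_mul_of_nonneg_left h2 hA0.le)) hD)
    have dd : ∀ {h : ℝ × ℝ → ℝ}, (∀ z, |h z| ≤ P z) → h =O[𝓟 (Ioi 0 ×ˢ Ioo 0 T)] P :=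
      fun {h} hb => .of_bound 1 (Eventually.of_forall fun z => by
        rw [one_mul, norm_eq_abs, norm_eq_abs, abs_of_nonneg (hP0 z)]
        exact hb z)
    have hrem := isBigO_momentum_remainder (ι := ℝ × ℝ) (l := 𝓟 (Ioi 0 ×ˢ Ioo 0 T)) (μ := μ) (κ := κ)
      (w₁ := fun z => deriv V (z.1 - s * z.2 + α - β))
      (w₂ := fun z => deriv (deriv V) (z.1 - s * z.2 + α - β))
      (w₃ := fun z => deriv (deriv (deriv V)) (z.1 - s * z.2 + α - β))
      (u₁ := fun z => deriv U (z.1 - s * z.2 + α - β))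
      (u₂ := fun z => deriv (deriv U) (z.1 - s * z.2 + α - β))
      (f := fun z => pdx φ z.1 z.2) (f₁ := fun z => pdx (pdx φ) z.1 z.2)
      (f₂ := fun z => pdx (pdx (pdx φ)) z.1 z.2) (g := fun z => pdx (pdx ψ) z.1 z.2)
      (q := fun z => deriv p (V (z.1 - s * z.2 + α - β) + pdx φ z.1 z.2))
      (q₀ := fun z => deriv p (V (z.1 - s * z.2 + α - β)))
      (I := fun z => (V (z.1 - s * z.2 + α - β) + pdx φ z.1 z.2)⁻¹)
      (J := fun z => (V (z.1 - s * z.2 + α - β))⁻¹) (P := P)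
      (bd fun x hx t ht => bV1 _)
      (bd (B := 3 / 2 * vp) fun x hx t ht => by
        have h1 := hv x hx.le t ⟨ht.1.le, ht.2.le⟩
        have h2 := hVv (x - s * t + α - β)
        rw [abs_le]
        constructor <;> linarith [h2.1, h2.2])
      (bd fun x hx t ht => bφ2 x hx.le t ⟨ht.1.le, ht.2.le⟩)
      (bd fun x hx t ht => hQ _ (hv x hx.le t ⟨ht.1.le, ht.2.le⟩))
      (bd fun x hx t ht => hQ _ (by
        have h2 := hVv (x - s * t + α - β)
        constructor <;> linarith [h2.1, h2.2]))
      (bd (B := (vm / 2)⁻¹) fun x hx t ht => by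
        have h1 := (hv x hx.le t ⟨ht.1.le, ht.2.le⟩).1
        rw [abs_of_nonneg (inv_nonneg.2 (by linarith))]
        exact inv_anti₀ (by linarith) h1)
      (bd (B := vm⁻¹) fun x hx t ht => by
        have h1 := (hVv (x - s * t + α - β)).1
        rw [abs_of_nonneg (inv_nonneg.2 (by linarith))]
        exact inv_anti₀ hvm h1)
      (de fun ξ => by linarith [hd₁ ξ, abs_nonneg (deriv U ξ)])
      (de fun ξ => by linarith [hd₂ ξ, abs_nonneg (deriv (deriv U) ξ)])
      (de fun ξ => by linarith [hd₃ ξ, abs_nonneg (deriv (deriv (deriv U)) ξ)])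
      (de fun ξ => by linarith [hd₁ ξ, abs_nonneg (deriv V ξ)])
      (de fun ξ => by linarith [hd₂ ξ, abs_nonneg (deriv (deriv V) ξ)])
      (dd fun z => (hPle z).1) (dd fun z => (hPle z).2.1) (dd fun z => (hPle z).2.2.1)
    obtain ⟨M, hM⟩ := hrem.bound
    refine ⟨M, fun x hx t ht => ?_⟩
    have hv' := (hv x hx.le t ⟨ht.1.le, ht.2.le⟩).1
    have hV' := (hVv (x - s * t + α - β)).1
    have d := (hasDerivAt_momentum (p := p) (W := fun y => V (y - s * t + α - β))
      (w₁ := fun y => deriv V (y - s * t + α - β))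
      (w₂ := fun y => deriv (deriv V) (y - s * t + α - β))
      (u₁ := fun y => deriv U (y - s * t + α - β))
      (f := fun y => pdx φ y t) (f₁ := fun y => pdx (pdx φ) y t)
      (f₂ := fun y => pdx (pdx (pdx φ)) y t) (g := fun y => pdx (pdx ψ) y t)
      (μ := μ) (κ := κ)
      (shx hV x t) (shx hV1 x t) (shx hV2 x t) (shx hU1 x t) (hasDerivAt_pdx hφ1 x t)
      (hasDerivAt_pdx hφ2 x t) (hasDerivAt_pdx hφ3 x t) (hasDerivAt_pdx hψ2 x t)
      (pdp _ (by linarith)) (pdp _ (by linarith)) (ne_of_gt (by linarith))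
      (ne_of_gt (by linarith)) rfl rfl).congr_of_eventuallyEq (f₁ := fun y => pdt ψ y t) <| by
        filter_upwards [Ioi_mem_nhds hx] with y hy
        have h1 := hmom y hy t ht
        have h2 := (hv y (le_of_lt hy) t ⟨ht.1.le, ht.2.le⟩).1
        have h3 := (hVv (y - s * t + α - β)).1
        exact eq_momentum_of_NSKF (ne_of_gt (by linarith)) (ne_of_gt (by linarith)) h1
    have h1 := eventually_principal.1 hM (x, t) ⟨hx, ht⟩
    rw [norm_eq_abs, norm_eq_abs, abs_of_nonneg (hP0 _), hP] at h1
    rw [← pdx_pdt_comm hψ x t]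
    refine le_of_eq_of_le (congrArg abs ?_) h1
    rw [show pdx (pdt ψ) x t = _ from d.deriv]
    ring
  obtain ⟨K, hK⟩ : ∃ K, K = 4 * M ^ 2 + 1 := ⟨_, rfl⟩
  have hK1 : 1 ≤ K := by
    rw [hK]
    linarith [sq_nonneg M]
  have hxt : ∀ x > 0, ∀ t ∈ Ioo 0 T, pdt (pdx φ) x t = pdx (pdx ψ) x t := fun x hx t ht => by
    rw [← pdx_pdt_comm hφ x t]
    exact pdx_congr (fun y hy => sub_eq_zero.1 (hmass y hy t ht)) hx
  have hxxt : ∀ x > 0, ∀ t ∈ Ioo 0 T, pdt (pdx (pdx φ)) x t = pdx (pdx (pdx ψ)) x t :=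
    fun x hx t ht => by
      rw [← pdx_pdt_comm hφ1 x t]
      exact pdx_congr (fun y hy => hxt y hy t ht) hx
  have vp0 : 0 ≤ |s| * D := mul_nonneg (abs_nonneg s) hD
  have cE : Continuous fun x : ℝ => exp (-(c * x)) := by fun_prop
  have hN : Continuous fun z : ℝ × ℝ => K * (pdx (pdx φ) z.1 z.2 ^ 2
      + pdx (pdx (pdx φ)) z.1 z.2 ^ 2 + pdx (pdx ψ) z.1 z.2 ^ 2 + exp (-(c * z.1)) ^ 2) := by
    have h1 : Continuous fun z : ℝ × ℝ => pdx (pdx φ) z.1 z.2 := hφ2.continuous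
    have h2 : Continuous fun z : ℝ × ℝ => pdx (pdx (pdx φ)) z.1 z.2 := hφ3.continuous
    have h3 : Continuous fun z : ℝ × ℝ => pdx (pdx ψ) z.1 z.2 := hψ2.continuous
    fun_prop
  have hc2 : 0 ≤ K * (3 + (2 * c)⁻¹) := by positivity
  suffices hex : ∃ M', ∀ R ≥ 1, ∫ t in (0:ℝ)..T, ∫ x in (0:ℝ)..R,
      ((1 - x / R) * pdx (pdx (pdx (pdx φ))) x t) ^ 2 ≤ M' by
    obtain ⟨M', hM'⟩ := hex
    exact intervalIntegrable_sqnorm_of_weighted_bound (contDiff_pdx hφ3).continuous hT hM'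
  refine exists_weighted_dissipation_bound (a := pdx ψ) (b := pdx (pdx φ))
    (v := fun x t => V (x - s * t + α - β) + pdx φ x t)
    (N := fun x t => K * (pdx (pdx φ) x t ^ 2 + pdx (pdx (pdx φ)) x t ^ 2 + pdx (pdx ψ) x t ^ 2
      + exp (-(c * x)) ^ 2))
    (M := |s| * D + (D + 2) + 2 + K * (3 + (2 * c)⁻¹)) (T := T)
    hψ1 hφ2 hvs hN hμ hκ (half_pos hvm) (by linarith) hT hxxt
    (fun x hx t ht => ?_) (fun x hx t ht => ?_) (fun x hx t ht => ?_)
    (fun x hx t ht => (bψ1 x hx.le t ⟨ht.1.le, ht.2.le⟩).trans (by linarith))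
    hv
    (fun x hx t ht => ?_) (fun x hx t ht => ?_) (fun R hR t ht => ?_)
  · refine (sq_le_sq' (abs_le.1 (hM x hx t ht)).1 (abs_le.1 (hM x hx t ht)).2).trans ?_
    have key : ∀ m a b d e : ℝ, (m * (|a| + |b| + |d| + e)) ^ 2
        ≤ (4 * m ^ 2 + 1) * (a ^ 2 + b ^ 2 + d ^ 2 + e ^ 2) := by
      intro m a b d e
      have h1 : (|a| + |b| + |d| + e) ^ 2 ≤ 4 * (a ^ 2 + b ^ 2 + d ^ 2 + e ^ 2) := by
        rw [← sq_abs a, ← sq_abs b, ← sq_abs d]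
        linarith only [sq_nonneg (|a| - |b|), sq_nonneg (|a| - |d|), sq_nonneg (|a| - e),
          sq_nonneg (|b| - |d|), sq_nonneg (|b| - e), sq_nonneg (|d| - e)]
      have h2 := mul_le_mul_of_nonneg_left h1 (sq_nonneg m)
      rw [mul_pow]
      linarith only [h2, sq_nonneg a, sq_nonneg b, sq_nonneg d, sq_nonneg e]
    rw [hK]
    exact key _ _ _ _ _
  · have h1 : pdt (fun x t => V (x - s * t + α - β) + pdx φ x t) x t
        = -s * deriv V (x - s * t + α - β) + pdt (pdx φ) x t :=
      ((sht x t).fun_add (hasDerivAt_pdt hφ1 x t)).deriv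
    rw [h1, hxt x hx t ht, add_sub_cancel_right, abs_mul, abs_neg]
    have := mul_le_mul_of_nonneg_left (bV1 (x - s * t + α - β)) (abs_nonneg s)
    linarith
  · have h1 : pdx (fun x t => V (x - s * t + α - β) + pdx φ x t) x t
        = deriv V (x - s * t + α - β) + pdx (pdx φ) x t :=
      ((shx hV x t).fun_add (hasDerivAt_pdx hφ1 x t)).deriv
    rw [h1]
    have h2 := bφ2 x hx.le t ⟨ht.1.le, ht.2.le⟩
    have h3 := bV1 (x - s * t + α - β)
    have h4 := abs_add_le (deriv V (x - s * t + α - β)) (pdx (pdx φ) x t)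
    linarith
  · refine le_trans ?_ (le_mul_of_one_le_left (by positivity) hK1)
    linarith only [sq_nonneg (pdx (pdx φ) x t), sq_nonneg (pdx (pdx (pdx φ)) x t),
      sq_nonneg (exp (-(c * x)))]
  · refine le_trans ?_ (le_mul_of_one_le_left (by positivity) hK1)
    linarith only [sq_nonneg (pdx (pdx φ) x t), sq_nonneg (pdx (pdx ψ) x t),
      sq_nonneg (exp (-(c * x)))]
  · have hle : ∀ {f : ℝ → ℝ}, IntegrableOn (fun x => f x ^ 2) (Ioi 0) →
        ∫ x in (0:ℝ)..R, f x ^ 2 ≤ ∫ x in Ioi 0, f x ^ 2 := fun hf => by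
      rw [intervalIntegral.integral_of_le hR]
      exact setIntegral_mono_set hf (ae_of_all _ fun _ => sq_nonneg _)
        (Ioc_subset_Ioi_self.eventuallyLE)
    have i1 := hle (hφi t ht 2 (by norm_num)).1
    have i2 := hle (hφi t ht 3 (by norm_num)).1
    have i3 := hle (hψi t ht 2 (by norm_num)).1
    have n1 := hφN t ht 2 (by norm_num)
    have n2 := hφN t ht 3 (by norm_num)
    have n3 := hψN t ht 2 (by norm_num)
    have hexp : (fun x : ℝ => exp (-(c * x)) ^ 2) = fun x => exp (-(2 * c) * x) := by
      funext x
      rw [← exp_nat_mul]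
      congr 1
      push_cast
      ring
    have i4 : ∫ x in (0:ℝ)..R, exp (-(c * x)) ^ 2 ≤ (2 * c)⁻¹ := by
      refine (hle ?_).trans (le_of_eq ?_)
      · rw [hexp]
        exact integrableOn_exp_mul_Ioi (by linarith) 0
      · rw [hexp, integral_exp_mul_Ioi (by linarith) 0]
        simp
    have hint : ∀ {f : ℝ → ℝ}, Continuous f →
        IntervalIntegrable (fun x => f x ^ 2) volume 0 R := fun hf =>
      (hf.pow 2).intervalIntegrable 0 R
    have c1 := hint (continuous_of_contDiff_left hφ2 t)
    have c2 := hint (continuous_of_contDiff_left hφ3 t)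
    have c3 := hint (continuous_of_contDiff_left hψ2 t)
    have c4 := hint cE
    rw [intervalIntegral.integral_const_mul,
      intervalIntegral.integral_add ((c1.add c2).add c3) c4,
      intervalIntegral.integral_add (c1.add c2) c3, intervalIntegral.integral_add c1 c2]
    refine (mul_le_mul_of_nonneg_left ?_ (by linarith : 0 ≤ K)).trans
      (le_add_of_nonneg_left (by linarith))
    simp only [sqnorm, Function.iterate_succ, Function.iterate_zero, Function.comp_apply, id_eq]
      at i1 i2 i3 n1 n2 n3
    linarith

theorem abs_integral_le_of_abs_le_add_exp {F Y : ℝ → ℝ} {B c t : ℝ} (ht : 0 ≤ t) (hc : 0 < c)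
    (hB : 0 ≤ B) (hY : IntervalIntegrable Y volume 0 t)
    (hF : ∀ τ ∈ Ioo 0 t, |F τ| ≤ Y τ + B * exp (-c * τ)) :
    |∫ τ in (0:ℝ)..t, F τ| ≤ (∫ τ in (0:ℝ)..t, Y τ) + B * c⁻¹ := by
  have cE : Continuous fun τ : ℝ => B * exp (-c * τ) := by fun_prop
  have hE := cE.intervalIntegrable (μ := volume) 0 t
  have h1 : ‖∫ τ in (0:ℝ)..t, F τ‖ ≤ ∫ τ in (0:ℝ)..t, Y τ + B * exp (-c * τ) := by
    refine intervalIntegral.norm_integral_le_of_norm_le ht ?_ (hY.add hE)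
    filter_upwards [compl_mem_ae_iff.2 (measure_singleton t)] with τ hτ hτ'
    exact hF τ ⟨hτ'.1, lt_of_le_of_ne hτ'.2 hτ⟩
  rw [norm_eq_abs, intervalIntegral.integral_add hY hE, intervalIntegral.integral_const_mul] at h1
  refine h1.trans (add_le_add_right (mul_le_mul_of_nonneg_left ?_ hB) _)
  rw [intervalIntegral.integral_of_le ht]
  refine (setIntegral_mono_set (integrableOn_exp_mul_Ioi (by linarith) 0)
    (ae_of_all _ fun _ => (exp_pos _).le) Ioc_subset_Ioi_self.eventuallyLE).trans (le_of_eq ?_)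
  rw [integral_exp_mul_Ioi (by linarith) 0]
  simp

theorem pow_four_le_of_forall_sq_le {y e X : ℝ} (he : 0 < e) (hX : 0 ≤ X)
    (h : ∀ θ > 0, y ^ 2 ≤ θ * e ^ 2 + θ⁻¹ * X) : y ^ 4 ≤ 4 * e ^ 2 * X := by
  rcases eq_or_ne y 0 with rfl | hy
  · have : 0 ≤ 4 * e ^ 2 * X := by positivity
    simpa using this
  · have hy2 : 0 < y ^ 2 := by positivity
    have h1 := mul_le_mul_of_nonneg_left (h (y ^ 2 / (2 * e ^ 2)) (by positivity)) hy2.le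
    have h2 : y ^ 2 * (y ^ 2 / (2 * e ^ 2) * e ^ 2 + (y ^ 2 / (2 * e ^ 2))⁻¹ * X)
        = y ^ 4 / 2 + 2 * e ^ 2 * X := by
      field_simp
    rw [h2] at h1
    linarith

theorem abs_mul_cube_le {y h e X : ℝ} (he : 0 < e) (hh : 0 ≤ h) (hX : 0 ≤ X)
    (hy : ∀ θ > 0, y ^ 2 ≤ θ * e ^ 2 + θ⁻¹ * X) :
    |y| * h ^ 3 ≤ √e * X + √e * h ^ 4 := by
  have h1 := pow_four_le_of_forall_sq_le he hX hy
  have hs : 0 < √e := sqrt_pos.2 he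
  have hs2 : √e ^ 2 = e := sq_sqrt he.le
  have young : ∀ a b : ℝ, 0 ≤ a → 0 ≤ b → a * b ^ 3 ≤ a ^ 4 / 4 + b ^ 4 := by
    intro a b ha hb
    have : 0 ≤ (a - b) ^ 2 * (a ^ 2 + 2 * a * b + 3 * b ^ 2) := by positivity
    linarith [pow_nonneg hb 4]
  have h2 := mul_le_mul_of_nonneg_left (young (|y| / √e) h (by positivity) hh) hs.le
  have h3 : (|y| / √e) ^ 4 / 4 ≤ X := by
    have : √e ^ 4 = e ^ 2 := by
      calc √e ^ 4 = (√e ^ 2) ^ 2 := by ring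
        _ = e ^ 2 := by rw [hs2]
    rw [div_pow, this, (by decide : Even 4).pow_abs, div_div, div_le_iff₀ (by positivity)]
    linarith
  have h4 : √e * (|y| / √e * h ^ 3) = |y| * h ^ 3 := by field_simp
  have h5 := mul_le_mul_of_nonneg_left h3 hs.le
  linarith

/-- Boundary estimates (third group), for the boundary terms involving `φ_xxx`: (i) the `φ_xxx φ_txx / v⁵` term, (ii) the `ψ_tx φ_xxx` term with an `η`-Young splitting. -/
theorem boundary_estimates_third
    (p : ℝ → ℝ) (μ κ s c₁ C₁ vm vp : ℝ)
    (hp : ContDiffOn ℝ (⊤ : ℕ∞) p (Set.Ioi 0))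
    (hp1 : ∀ v > (0:ℝ), deriv p v < 0)
    (hp2 : ∀ v > (0:ℝ), deriv (deriv p) v > 0)
    (hμ : 0 < μ) (hκ : 0 < κ) (hs : 0 < s) (hc₁ : 0 < c₁) (hC₁ : 0 < C₁)
    (hvm : 0 < vm) (hvmvp : vm < vp) :
    ∃ δ₀ > 0, ∃ ε₀ > 0, ∃ C > 0, ∀ η > 0, ∃ Cη > 0,
      ∀ (up α β T ε : ℝ) (V U : ℝ → ℝ) (φ ψ : ℝ → ℝ → ℝ),
        up < 0 → |α| < 1 → 1 < β → 0 < T → 0 < ε → ε < 1 →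
        ContDiff ℝ (⊤ : ℕ∞) V → ContDiff ℝ (⊤ : ℕ∞) U →
        (∀ ξ : ℝ, s * V ξ + U ξ = s * vm) →
        (∀ ξ : ℝ, μ * deriv U ξ / V ξ - κ * deriv (deriv V) ξ / (V ξ) ^ 5
            + (5 * κ / 2) * (deriv V ξ) ^ 2 / (V ξ) ^ 6
          = -(s * U ξ) + p (V ξ) - p vm) →
        (∀ ξ : ℝ, 0 < deriv V ξ) → (∀ ξ : ℝ, deriv U ξ < 0) →
        (∀ ξ ≤ (0:ℝ), |V ξ - vm| + |U ξ| ≤ C₁ * (vp - vm) * Real.exp (c₁ * ξ)) →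
        (∀ ξ ≥ (0:ℝ), |V ξ - vp| + |U ξ - up| ≤ C₁ * (vp - vm) * Real.exp (-(c₁ * ξ))) →
        (∀ ξ : ℝ, |deriv V ξ| + |deriv U ξ|
          ≤ C₁ * (vp - vm) ^ 2 * Real.exp (-(c₁ * |ξ|))) →
        (∀ ξ : ℝ, |deriv (deriv V) ξ| + |deriv (deriv U) ξ|
          ≤ C₁ * (vp - vm) ^ 2 * Real.exp (-(c₁ * |ξ|))) →
        (∀ ξ : ℝ, |deriv (deriv (deriv V)) ξ| + |deriv (deriv (deriv U)) ξ|
          ≤ C₁ * (vp - vm) ^ 2 * Real.exp (-(c₁ * |ξ|))) →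
        ContDiff ℝ (⊤ : ℕ∞) (Function.uncurry φ) →
        ContDiff ℝ (⊤ : ℕ∞) (Function.uncurry ψ) →
        (∀ t ∈ Set.Icc (0:ℝ) T, ∀ j ≤ 4,
          IntegrableOn (fun x => (pdx^[j] φ x t) ^ 2) (Set.Ioi 0) ∧
          Tendsto (fun x => pdx^[j] φ x t) atTop (nhds 0)) →
        (∀ t ∈ Set.Icc (0:ℝ) T, ∀ j ≤ 3,
          IntegrableOn (fun x => (pdx^[j] ψ x t) ^ 2) (Set.Ioi 0) ∧
          Tendsto (fun x => pdx^[j] ψ x t) atTop (nhds 0)) →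
        (∀ x ≥ (0:ℝ), ∀ t ∈ Set.Icc (0:ℝ) T,
          vm / 2 ≤ V (x - s * t + α - β) + pdx φ x t ∧
          V (x - s * t + α - β) + pdx φ x t ≤ 3 / 2 * vp) →
        (∀ x ∈ Set.Ioi (0:ℝ), ∀ t ∈ Set.Ioo (0:ℝ) T, pdt φ x t - pdx ψ x t = 0) →
        (∀ x ∈ Set.Ioi (0:ℝ), ∀ t ∈ Set.Ioo (0:ℝ) T,
          pdt ψ x t + deriv p (V (x - s * t + α - β)) * pdx φ x t
            - μ / V (x - s * t + α - β) * pdx (pdx ψ) x t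
            + κ * pdx (pdx (pdx φ)) x t / (V (x - s * t + α - β) + pdx φ x t) ^ 5
            + μ * deriv U (x - s * t + α - β) * pdx φ x t / (V (x - s * t + α - β)) ^ 2
          = NSKF p μ κ s α β V U φ ψ x t) →
        (∀ t ∈ Set.Icc (0:ℝ) T, φ 0 t = ∫ τ in Set.Ici t, U (-(s * τ) + α - β)) →
        (∀ t ∈ Set.Icc (0:ℝ) T, pdx ψ 0 t = -U (-(s * t) + α - β)) →
        (∀ t ∈ Set.Icc (0:ℝ) T,
          pdx (pdx φ) 0 t = (s ^ 2)⁻¹ * (s * deriv U (-(s * t) + α - β))) →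
        (∀ t ∈ Set.Icc (0:ℝ) T, Real.sqrt (Hsq 3 φ t) + Real.sqrt (Hsq 2 ψ t) ≤ ε) →
        vp - vm ≤ δ₀ → ε ≤ ε₀ →
        ∀ t ∈ Set.Icc (0:ℝ) T,
          (|∫ τ in (0:ℝ)..t, pdx (pdx (pdx φ)) 0 τ * pdx (pdx (pdt φ)) 0 τ /
              (V (-(s * τ) + α - β) + pdx φ 0 τ) ^ 5|
            ≤ C * Real.sqrt ε * (∫ τ in (0:ℝ)..t, sqnorm (pdx^[4] φ) τ)
              + C * Real.sqrt ε * Real.exp (-(4 / 3 * (c₁ * β)))) ∧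
          (|∫ τ in (0:ℝ)..t, pdx (pdt ψ) 0 τ * pdx (pdx (pdx φ)) 0 τ|
            ≤ η * (∫ τ in (0:ℝ)..t, sqnorm (pdx^[4] φ) τ)
              + Cη * (∫ τ in (0:ℝ)..t, sqnorm (pdx^[3] φ) τ)
              + Cη * Real.exp (-(c₁ * β))) := by
  obtain ⟨D, hD⟩ : ∃ D, D = C₁ * (vp - vm) ^ 2 := ⟨_, rfl⟩
  have hD0 : 0 < D := by
    rw [hD]
    have : 0 < vp - vm := sub_pos.2 hvmvp
    positivity
  obtain ⟨K, hK⟩ : ∃ K, K = D * exp c₁ := ⟨_, rfl⟩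
  have hK0 : 0 < K := by
    rw [hK]
    positivity
  obtain ⟨L, hL⟩ : ∃ L, L = K * (2 / vm) ^ 5 := ⟨_, rfl⟩
  have hL0 : 0 < L := by
    rw [hL]
    positivity
  refine ⟨1, one_pos, 1, one_pos, L * (1 + (4 / 3 * (c₁ * s))⁻¹), by positivity, fun η hη =>
    ⟨η⁻¹ + (s * K) ^ 2 * (2 * (c₁ * s))⁻¹, by positivity, ?_⟩⟩
  intro up α β T ε V U φ ψ _ hα hβ hT hε hε1 hV hU _ _ hV' _ hVm hVp hd₁ hd₂ hd₃ hφ hψ hφi hψi hv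
    hmass hmom _ hb₁ hb₂ hN _ _ t ht
  rw [← hD] at hd₁ hd₂ hd₃
  have hφ1 := contDiff_pdx hφ
  have hφ3 := contDiff_pdx (contDiff_pdx hφ1)
  have hφN : ∀ t ∈ Icc 0 T, ∀ j ≤ 3, sqnorm (pdx^[j] φ) t ≤ ε ^ 2 := fun t ht j hj =>
    sqnorm_le_of_sqrt_Hsq_le hε.le (by linarith [hN t ht, sqrt_nonneg (Hsq 2 ψ t)]) hj
  have hψN : ∀ t ∈ Icc 0 T, ∀ j ≤ 2, sqnorm (pdx^[j] ψ) t ≤ ε ^ 2 := fun t ht j hj =>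
    sqnorm_le_of_sqrt_Hsq_le hε.le (by linarith [hN t ht, sqrt_nonneg (Hsq 3 φ t)]) hj
  have hε2 : ε ^ 2 ≤ 1 := pow_le_one₀ hε.le hε1.le
  have i4 : IntervalIntegrable (sqnorm (pdx^[4] φ)) volume 0 t := by
    have hVv := monotone_profile_mem_Icc (V := V) (vm := vm) (vp := vp) (B := C₁ * (vp - vm)) hc₁
      (monotone_of_deriv_nonneg (hV.differentiable (by simp)) fun ξ => (hV' ξ).le)
      (fun ξ hξ => by linarith [hVm ξ hξ, abs_nonneg (U ξ)])
      (fun ξ hξ => by linarith [hVp ξ hξ, abs_nonneg (U ξ - up)])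
    refine (intervalIntegrable_sqnorm_pdx_four hp hμ hκ hc₁ hvm hT hV hU hVv hd₁ hd₂ hd₃ hφ hψ
      hφi hψi hv hmass hmom (fun t ht j hj => (hφN t ht j hj).trans hε2)
      (fun t ht j hj => (hψN t ht j hj).trans hε2)).mono_set ?_
    rw [uIcc_of_le ht.1, uIcc_of_le hT.le]
    exact Icc_subset_Icc_right ht.2
  have i3 : IntervalIntegrable (sqnorm (pdx^[3] φ)) volume 0 t := by
    rw [intervalIntegrable_iff_integrableOn_Ioc_of_le ht.1]
    refine Measure.integrableOn_of_bounded (M := ε ^ 2) (by simp)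
      (stronglyMeasurable_sqnorm hφ3.continuous).aestronglyMeasurable ?_
    refine (ae_restrict_mem measurableSet_Ioc).mono fun τ hτ => ?_
    rw [norm_eq_abs, abs_of_nonneg (sqnorm_nonneg _ _)]
    exact hφN τ ⟨hτ.1.le, hτ.2.trans ht.2⟩ 3 le_rfl
  have sob : ∀ τ ∈ Ioo 0 t, ∀ θ > 0, pdx (pdx (pdx φ)) 0 τ ^ 2
      ≤ θ * sqnorm (pdx^[3] φ) τ + θ⁻¹ * sqnorm (pdx^[4] φ) τ := fun τ hτ θ hθ => by
    have hτ' : τ ∈ Icc 0 T := ⟨hτ.1.le, hτ.2.le.trans ht.2⟩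
    exact sq_le_of_integrableOn_Ioi (fun x => hasDerivAt_pdx hφ3 x τ)
      (continuous_of_contDiff_left (contDiff_pdx hφ3) τ) (hφi τ hτ' 3 (by norm_num)).1
      (hφi τ hτ' 4 le_rfl).1 (hφi τ hτ' 3 (by norm_num)).2 hθ le_rfl
  have hdec : ∀ τ, D * exp (-(c₁ * |-(s * τ) + α - β|)) ≤ K * exp (-(c₁ * (β + s * τ))) := by
    intro τ
    rw [hK, mul_assoc, ← exp_add]
    refine mul_le_mul_of_nonneg_left (exp_le_exp.2 ?_) hD0.le
    have h1 := neg_le_abs (-(s * τ) + α - β)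
    have h2 := (abs_lt.1 hα).2
    have := mul_le_mul_of_nonneg_left
      (by linarith : β + s * τ - 1 ≤ |-(s * τ) + α - β|) hc₁.le
    linarith
  have hshift : ∀ τ, HasDerivAt (fun r => -(s * r) + α - β) (-s) τ := fun τ => by
    simpa using ((((hasDerivAt_id τ).const_mul s).neg.add_const α).sub_const β)
  have hbd : ∀ {f g : ℝ → ℝ} {τ : ℝ}, τ ∈ Ioo 0 t → (∀ r ∈ Icc 0 T, f r = g r) →
      deriv f τ = deriv g τ := fun {f g τ} hτ h =>
    EventuallyEq.deriv_eq (mem_of_superset (Icc_mem_nhds hτ.1 (hτ.2.trans_le ht.2)) h)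
  have bφ : ∀ τ ∈ Ioo 0 t, |pdx (pdx (pdt φ)) 0 τ| ≤ K * exp (-(c₁ * (β + s * τ))) := by
    intro τ hτ
    have hcomm : pdx (pdt φ) = pdt (pdx φ) := funext₂ (pdx_pdt_comm hφ)
    have hU2 := ((show ContDiff ℝ (⊤ : ℕ∞) (deriv U) from hU.deriv').differentiable (by simp)
      (-(s * τ) + α - β)).hasDerivAt
    have h1 : pdx (pdx (pdt φ)) 0 τ = -deriv (deriv U) (-(s * τ) + α - β) := by
      rw [hcomm, pdx_pdt_comm hφ1 0 τ]
      refine (hbd hτ hb₂).trans ?_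
      refine ((((HasDerivAt.comp τ hU2 (hshift τ)).const_mul s).const_mul (s ^ 2)⁻¹).deriv).trans ?_
      field_simp
    rw [h1, abs_neg]
    refine le_trans ?_ (hdec τ)
    linarith [hd₂ (-(s * τ) + α - β), abs_nonneg (deriv (deriv V) (-(s * τ) + α - β))]
  have bψ : ∀ τ ∈ Ioo 0 t, |pdx (pdt ψ) 0 τ| ≤ s * K * exp (-(c₁ * (β + s * τ))) := by
    intro τ hτ
    have hU1 := (hU.differentiable (by simp) (-(s * τ) + α - β)).hasDerivAt
    have h1 : pdx (pdt ψ) 0 τ = s * deriv U (-(s * τ) + α - β) := by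
      rw [pdx_pdt_comm hψ 0 τ]
      refine (hbd hτ hb₁).trans ?_
      refine ((HasDerivAt.comp τ hU1 (hshift τ)).neg.deriv).trans ?_
      ring
    rw [h1, abs_mul, abs_of_pos hs, mul_assoc]
    refine mul_le_mul_of_nonneg_left (le_trans ?_ (hdec τ)) hs.le
    linarith [hd₁ (-(s * τ) + α - β), abs_nonneg (deriv V (-(s * τ) + α - β))]
  constructor
  · have key := abs_integral_le_of_abs_le_add_exp ht.1 (c := 4 / 3 * (c₁ * s)) (by positivity)
      (B := L * √ε * exp (-(4 / 3 * (c₁ * β)))) (by positivity)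
      (i4.const_mul (L * √ε)) (F := fun τ => pdx (pdx (pdx φ)) 0 τ * pdx (pdx (pdt φ)) 0 τ /
        (V (-(s * τ) + α - β) + pdx φ 0 τ) ^ 5) ?_
    · rw [intervalIntegral.integral_const_mul] at key
      refine key.trans ?_
      have h1 : 0 ≤ ∫ τ in (0:ℝ)..t, sqnorm (pdx^[4] φ) τ :=
        intervalIntegral.integral_nonneg ht.1 fun τ _ => sqnorm_nonneg _ _
      have h2 : 0 ≤ L * (4 / 3 * (c₁ * s))⁻¹ * √ε * ∫ τ in (0:ℝ)..t, sqnorm (pdx^[4] φ) τ := by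
        positivity
      have h3 : 0 ≤ L * √ε * exp (-(4 / 3 * (c₁ * β))) := by positivity
      linarith
    · intro τ hτ
      have hτ' : τ ∈ Icc 0 T := ⟨hτ.1.le, hτ.2.le.trans ht.2⟩
      have hv' : vm / 2 ≤ V (-(s * τ) + α - β) + pdx φ 0 τ := by
        simpa using (hv 0 le_rfl τ hτ').1
      have h1 : |((V (-(s * τ) + α - β) + pdx φ 0 τ) ^ 5)⁻¹| ≤ (2 / vm) ^ 5 := by
        rw [abs_of_nonneg (inv_nonneg.2 (pow_nonneg (by linarith) 5)), ← inv_pow,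
          ← inv_div vm 2]
        exact pow_le_pow_left₀ (inv_nonneg.2 (by linarith)) (inv_anti₀ (by linarith) hv') 5
      obtain ⟨h, hh⟩ : ∃ h, h = exp (-(c₁ * (β + s * τ)) / 3) := ⟨_, rfl⟩
      have h0 : 0 ≤ h := hh ▸ (exp_pos _).le
      have h3 : exp (-(c₁ * (β + s * τ))) = h ^ 3 := by
        rw [hh, ← exp_nat_mul]
        congr 1
        push_cast
        ring
      have h4 : exp (-(4 / 3 * (c₁ * β))) * exp (-(4 / 3 * (c₁ * s)) * τ) = h ^ 4 := by
        rw [hh, ← exp_nat_mul, ← exp_add]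
        congr 1
        push_cast
        ring
      have h5 := abs_mul_cube_le hε h0 (sqnorm_nonneg (pdx^[4] φ) τ) fun θ hθ =>
        (sob τ hτ θ hθ).trans (add_le_add_left
          (mul_le_mul_of_nonneg_left (hφN τ hτ' 3 le_rfl) hθ.le) _)
      have h6 := bφ τ hτ
      rw [h3] at h6
      rw [mul_assoc (L * √ε) (exp (-(4 / 3 * (c₁ * β)))), h4, div_eq_mul_inv, abs_mul, abs_mul]
      calc |pdx (pdx (pdx φ)) 0 τ| * |pdx (pdx (pdt φ)) 0 τ|
            * |((V (-(s * τ) + α - β) + pdx φ 0 τ) ^ 5)⁻¹|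
          ≤ |pdx (pdx (pdx φ)) 0 τ| * (K * h ^ 3) * (2 / vm) ^ 5 := by gcongr
        _ = L * (|pdx (pdx (pdx φ)) 0 τ| * h ^ 3) := by rw [hL]; ring
        _ ≤ L * (√ε * sqnorm (pdx^[4] φ) τ + √ε * h ^ 4) := by gcongr
        _ = L * √ε * sqnorm (pdx^[4] φ) τ + L * √ε * h ^ 4 := by ring
  · have key := abs_integral_le_of_abs_le_add_exp ht.1 (c := 2 * (c₁ * s)) (by positivity)
      (B := (s * K) ^ 2 * exp (-(c₁ * β))) (by positivity)
      ((i4.const_mul η).add (i3.const_mul η⁻¹))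
      (F := fun τ => pdx (pdt ψ) 0 τ * pdx (pdx (pdx φ)) 0 τ) ?_
    · rw [intervalIntegral.integral_add (i4.const_mul η) (i3.const_mul η⁻¹),
        intervalIntegral.integral_const_mul, intervalIntegral.integral_const_mul] at key
      refine key.trans ?_
      have h1 : 0 ≤ ∫ τ in (0:ℝ)..t, sqnorm (pdx^[3] φ) τ :=
        intervalIntegral.integral_nonneg ht.1 fun τ _ => sqnorm_nonneg _ _
      have h2 : 0 ≤ (s * K) ^ 2 * (2 * (c₁ * s))⁻¹ * ∫ τ in (0:ℝ)..t, sqnorm (pdx^[3] φ) τ := by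
        positivity
      have h3 : 0 ≤ η⁻¹ * exp (-(c₁ * β)) := by positivity
      linarith
    · intro τ hτ
      have h1 := sob τ hτ η⁻¹ (inv_pos.2 hη)
      rw [inv_inv] at h1
      have h2 := bψ τ hτ
      have h3 : exp (-(c₁ * (β + s * τ))) ^ 2 ≤ exp (-(c₁ * β)) * exp (-(2 * (c₁ * s)) * τ) := by
        rw [← exp_nat_mul, ← exp_add]
        refine exp_le_exp.2 ?_
        push_cast
        have : 0 ≤ c₁ * β := by positivity
        linarith
      have h4 : |pdx (pdt ψ) 0 τ| ^ 2 ≤ (s * K) ^ 2 * (exp (-(c₁ * β)) * exp (-(2 * (c₁ * s)) * τ)) :=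
        (pow_le_pow_left₀ (abs_nonneg _) h2 2).trans (by
          rw [mul_pow]
          exact mul_le_mul_of_nonneg_left h3 (sq_nonneg _))
      have h5 : |pdx (pdt ψ) 0 τ * pdx (pdx (pdx φ)) 0 τ|
          ≤ |pdx (pdt ψ) 0 τ| ^ 2 + pdx (pdx (pdx φ)) 0 τ ^ 2 := by
        rw [abs_mul, ← sq_abs (pdx (pdx (pdx φ)) 0 τ)]
        have := two_mul_le_add_sq |pdx (pdt ψ) 0 τ| |pdx (pdx (pdx φ)) 0 τ|
        have := mul_nonneg (abs_nonneg (pdx (pdt ψ) 0 τ)) (abs_nonneg (pdx (pdx (pdx φ)) 0 τ))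
        linarith
      linarith
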